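/- arXiv:1503.07063 — 3 statements merged into one kernel-verified Lean document; each statement's English description precedes it below -/
import Mathlib

section
/- Let ρ be a probability measure on ℝ³ and let c_n be an elementary cost of the form c_n(x) = Σ_{i=1}^{k} aᵢ χ_{Aᵢ¹}(x₁)⋯χ_{Aᵢᴺ}(x_N) with the sets arranged so that for each coordinate k the sets {Aᵢᵏ} are pairwise equal or disjoint. Then the multimarginal Kantorovich problem min{∫ c_n dP : P ∈ Π(ρ)} and its dual max{Σᵢ ∫ uᵢ dρ : uᵢ ∈ L¹(ρ), Σᵢ uᵢ(xᵢ) ≤ c_n(x) ρ^N-a.e.} have equal values, and the dual maximum is attained by an N-tuple of elementary (finitely-valued) functions. -/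
open MeasureTheory Filter Topology
open scoped ENNReal

noncomputable section

abbrev E3 := EuclideanSpace ℝ (Fin 3)

/-- A finitely generated convex cone in a real normed space is closed. -/
theorem isClosed_finite_cone {ι E : Type*} [NormedAddCommGroup E] [NormedSpace ℝ E]
    (v : ι → E) (t : Finset ι) :
    IsClosed {x | ∃ c : ι → ℝ, (∀ i, 0 ≤ c i) ∧ ∑ i ∈ t, c i • v i = x} := by
  classical
  induction t using Finset.strongInduction with
  | H t ih =>
  by_cases hli : LinearIndependent ℝ (fun i : t => v i)
  · let L : (t → ℝ) →ₗ[ℝ] E := Fintype.linearCombination ℝ (fun i : t => v i)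
    have hL : LinearMap.ker L = ⊥ :=
      LinearMap.ker_eq_bot.2
        (linearIndependent_iff_injective_fintypeLinearCombination.1 hli)
    have hcl : IsClosed {c : t → ℝ | ∀ i, 0 ≤ c i} := by
      simp only [Set.ofPred_forall]
      exact isClosed_iInter fun i => isClosed_le continuous_const (continuous_apply i)
    have himg : L '' {c : t → ℝ | ∀ i, 0 ≤ c i} =
        {x | ∃ c : ι → ℝ, (∀ i, 0 ≤ c i) ∧ ∑ i ∈ t, c i • v i = x} := by
      ext x
      constructor
      · rintro ⟨c, hc, rfl⟩
        refine ⟨fun i => if h : i ∈ t then c ⟨i, h⟩ else 0, fun i => ?_, ?_⟩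
        · dsimp only
          split_ifs with h
          exacts [hc ⟨i, h⟩, le_rfl]
        · rw [← Finset.sum_coe_sort t]
          simp [L, Fintype.linearCombination_apply]
      · rintro ⟨c, hc, rfl⟩
        refine ⟨fun i => c i, fun i => hc i, ?_⟩
        rw [← Finset.sum_coe_sort t]
        simp [L, Fintype.linearCombination_apply]
    rw [← himg]
    exact (LinearMap.isClosedEmbedding_of_injective hL).isClosedMap _ hcl
  · obtain ⟨d, hd, hpos⟩ : ∃ d : ι → ℝ, ∑ i ∈ t, d i • v i = 0 ∧ ∃ i ∈ t, 0 < d i := by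
      rw [Fintype.not_linearIndependent_iff] at hli
      obtain ⟨g, hg, i, hi⟩ := hli
      let d : ι → ℝ := fun i => if h : i ∈ t then g ⟨i, h⟩ else 0
      have hd : ∑ i ∈ t, d i • v i = 0 := by
        rw [← hg, ← Finset.sum_coe_sort t]
        simp [d]
      have hdi : d i = g i := by simp [d]
      rcases lt_or_gt_of_ne hi with h | h
      · exact ⟨-d, by simpa using hd, i, i.2, by simpa [hdi] using h⟩
      · exact ⟨d, hd, i, i.2, by simpa [hdi] using h⟩
    have hunion : {x | ∃ c : ι → ℝ, (∀ i, 0 ≤ c i) ∧ ∑ i ∈ t, c i • v i = x} =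
        ⋃ j ∈ t, {x | ∃ c : ι → ℝ, (∀ i, 0 ≤ c i) ∧ ∑ i ∈ t.erase j, c i • v i = x} := by
      ext x
      simp only [Set.mem_iUnion, Set.mem_ofPred_eq, exists_prop]
      constructor
      · rintro ⟨c, hc, rfl⟩
        obtain ⟨j, hj, hmin⟩ := Finset.exists_min_image (t.filter fun i => 0 < d i)
          (fun i => c i / d i) (by simpa [Finset.Nonempty] using hpos)
        simp only [Finset.mem_filter] at hj hmin
        set r := c j / d j with hr
        have hr0 : 0 ≤ r := div_nonneg (hc j) hj.2.le
        refine ⟨j, hj.1, fun i => if i ∈ t then c i - r * d i else 0, fun i => ?_, ?_⟩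
        · dsimp only
          split_ifs with hi
          · rcases lt_or_ge 0 (d i) with h | h
            · have := hmin i ⟨hi, h⟩
              rw [le_div_iff₀ h] at this
              linarith
            · nlinarith [hc i, mul_nonneg hr0 (neg_nonneg.2 h)]
          · exact le_rfl
        · have hz : c j - r * d j = 0 := by
            rw [hr, div_mul_cancel₀ _ hj.2.ne', sub_self]
          rw [Finset.sum_erase _ (by simp [hz])]
          calc _ = ∑ i ∈ t, (c i • v i - r • (d i • v i)) :=
                Finset.sum_congr rfl fun i hi => by simp [hi, sub_smul, mul_smul]
            _ = _ := by rw [Finset.sum_sub_distrib, ← Finset.smul_sum, hd]; simp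
      · rintro ⟨j, hj, c, hc, rfl⟩
        refine ⟨fun i => if i = j then 0 else c i, fun i => ?_, ?_⟩
        · dsimp only
          split_ifs
          exacts [le_rfl, hc i]
        · rw [← Finset.sum_erase (a := j) t (by simp)]
          exact Finset.sum_congr rfl fun i hi => by simp [Finset.ne_of_mem_erase hi]
    rw [hunion]
    exact isClosed_biUnion_finset fun j hj => ih _ (Finset.erase_ssubset hj)

/-- Strong duality for finite linear programs in standard form: if `p` minimizes the cost among
nonnegative vectors subject to the same linear constraints, then the dual program has a feasible
solution attaining the same value. -/
theorem exists_dual_of_isMin {S Y : Type*} [Fintype S] [Fintype Y]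
    (M : S → Y → ℝ) (C p : S → ℝ) (hp : ∀ s, 0 ≤ p s)
    (hmin : ∀ q : S → ℝ, (∀ s, 0 ≤ q s) → (∀ y, ∑ s, q s * M s y = ∑ s, p s * M s y) →
      ∑ s, p s * C s ≤ ∑ s, q s * C s) :
    ∃ w : Y → ℝ, (∀ s, ∑ y, w y * M s y ≤ C s) ∧
      ∑ s, p s * C s = ∑ y, w y * ∑ s, p s * M s y := by
  classical
  let m : Y → ℝ := fun y => ∑ s, p s * M s y
  let V : ℝ := ∑ s, p s * C s
  let v : Option S → (Y → ℝ) × ℝ := fun o => o.elim (-m, -V) fun s => (M s, C s)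
  let K : Set ((Y → ℝ) × ℝ) :=
    {x | ∃ c : Option S → ℝ, (∀ i, 0 ≤ c i) ∧ ∑ i ∈ Finset.univ, c i • v i = x}
  have hK : IsClosed K := isClosed_finite_cone v Finset.univ
  have hconv : Convex ℝ K := by
    rintro _ ⟨c, hc, rfl⟩ _ ⟨d, hd, rfl⟩ a b ha hb -
    refine ⟨fun i => a * c i + b * d i, fun i => add_nonneg (mul_nonneg ha (hc i))
      (mul_nonneg hb (hd i)), ?_⟩
    simp only [add_smul, mul_smul, Finset.sum_add_distrib, ← Finset.smul_sum]
  have hsmul : ∀ x ∈ K, ∀ r : ℝ, 0 ≤ r → r • x ∈ K := by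
    rintro _ ⟨c, hc, rfl⟩ r hr
    refine ⟨fun i => r * c i, fun i => mul_nonneg hr (hc i), ?_⟩
    simp only [mul_smul, ← Finset.smul_sum]
  have hgen : ∀ o, v o ∈ K := fun o =>
    ⟨fun i => if i = o then 1 else 0, fun i => by dsimp only; split_ifs <;> norm_num, by simp⟩
  have hnot : ((0 : Y → ℝ), (-1 : ℝ)) ∉ K := by
    rintro ⟨c, hc, hsum⟩
    rw [Fintype.sum_option] at hsum
    have h1 : ∀ y, ∑ s, c (some s) * M s y = c none * m y := fun y => by
      have := congrFun (congrArg Prod.fst hsum) y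
      simp [v, Prod.fst_sum, Finset.sum_apply] at this
      linarith
    have h2 : ∑ s, c (some s) * C s = c none * V - 1 := by
      have := congrArg Prod.snd hsum
      simp [v, Prod.snd_sum] at this
      linarith
    -- Moving from `p` in the direction `c - c none • p` would decrease the cost.
    have ht : 0 < 1 + c none := by linarith [hc none]
    have := hmin (fun s => (p s + c (some s)) / (1 + c none))
      (fun s => div_nonneg (add_nonneg (hp s) (hc _)) ht.le) (fun y => by
        have : ∑ s, (p s + c (some s)) / (1 + c none) * M s y =
            (∑ s, p s * M s y + ∑ s, c (some s) * M s y) / (1 + c none) := by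
          rw [← Finset.sum_add_distrib, Finset.sum_div]
          exact Finset.sum_congr rfl fun s _ => by ring
        rw [this, h1 y, div_eq_iff ht.ne']
        simp only [m]
        ring)
    have h3 : ∑ s, (p s + c (some s)) / (1 + c none) * C s =
        (∑ s, p s * C s + ∑ s, c (some s) * C s) / (1 + c none) := by
      rw [← Finset.sum_add_distrib, Finset.sum_div]
      exact Finset.sum_congr rfl fun s _ => by ring
    rw [h3, h2, le_div_iff₀ ht] at this
    simp only [V] at this
    linarith
  obtain ⟨f, u, hfu, hu⟩ := geometric_hahn_banach_point_closed hconv hK hnot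
  have hu0 : u < 0 := by
    simpa using hu 0 (by simpa using hsmul _ (hgen none) 0 le_rfl)
  have hnn : ∀ x ∈ K, 0 ≤ f x := by
    intro x hx
    by_contra! hneg
    have := hu _ (hsmul x hx (u / f x) (div_nonneg_of_nonpos hu0.le hneg.le))
    rw [map_smul, smul_eq_mul, div_mul_cancel₀ _ hneg.ne] at this
    exact lt_irrefl _ this
  let l : ℝ := f (0, 1)
  let g : Y → ℝ := fun y => f (Pi.single y 1, 0)
  have hf : ∀ z r, f (z, r) = ∑ y, z y * g y + r * l := by
    intro z r
    have : (z, r) = ∑ y, z y • ((Pi.single y 1 : Y → ℝ), (0 : ℝ)) + r • ((0 : Y → ℝ), (1 : ℝ)) := by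
      ext
      · simp [Prod.fst_sum, Finset.sum_apply, Pi.single_apply]
      · simp [Prod.snd_sum]
    rw [this, map_add, map_sum]
    simp_rw [map_smul, smul_eq_mul, g, l]
  have hl : 0 < l := by
    have := hfu.trans hu0
    rw [hf] at this
    simpa using this
  have hfeas : ∀ s, ∑ y, -(g y / l) * M s y ≤ C s := by
    intro s
    have : 0 ≤ ∑ y, M s y * g y + C s * l := by
      rw [← hf]
      exact hnn _ (hgen (some s))
    have h : ∑ y, -(g y / l) * M s y = -(∑ y, M s y * g y) / l := by
      rw [← Finset.sum_neg_distrib, Finset.sum_div]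
      exact Finset.sum_congr rfl fun y _ => by ring
    rw [h, div_le_iff₀ hl]
    linarith
  refine ⟨fun y => -(g y / l), hfeas, le_antisymm ?_ ?_⟩
  · have : 0 ≤ ∑ y, (-m) y * g y + -V * l := by
      rw [← hf]
      exact hnn _ (hgen none)
    have h : ∑ y, -(g y / l) * ∑ s, p s * M s y = (∑ y, (-m) y * g y) / l := by
      rw [Finset.sum_div]
      exact Finset.sum_congr rfl fun y _ => by simp only [m, Pi.neg_apply]; ring
    rw [h, le_div_iff₀ hl]
    simp only [V] at this
    linarith
  · calc ∑ y, -(g y / l) * ∑ s, p s * M s y = ∑ s, p s * ∑ y, -(g y / l) * M s y := by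
          simp_rw [Finset.mul_sum]
          rw [Finset.sum_comm]
          exact Finset.sum_congr rfl fun s _ => Finset.sum_congr rfl fun y _ => by ring
      _ ≤ _ := Finset.sum_le_sum fun s _ => mul_le_mul_of_nonneg_left (hfeas s) (hp s)

/-- Weak duality: potentials admissible for a cost have total integral at most the cost of any
coupling. -/
theorem sum_integral_le_integral_of_ae_le {ι Ω : Type*} [Fintype ι] [MeasurableSpace Ω]
    {ρ : Measure Ω} {P : Measure (ι → Ω)} (hP : ∀ i, P.map (fun x => x i) = ρ)
    {u : ι → Ω → ℝ} (hu : ∀ i, Integrable (u i) ρ) {c : (ι → Ω) → ℝ} (hc : Integrable c P)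
    (hle : ∀ᵐ x ∂P, ∑ i, u i (x i) ≤ c x) :
    ∑ i, ∫ y, u i y ∂ρ ≤ ∫ x, c x ∂P := by
  have hmp : ∀ i, MeasurePreserving (fun x : ι → Ω => x i) P ρ :=
    fun i => ⟨measurable_pi_apply i, hP i⟩
  have hint : ∀ i, Integrable (fun x : ι → Ω => u i (x i)) P :=
    fun i => (hmp i).integrable_comp_of_integrable (hu i)
  calc ∑ i, ∫ y, u i y ∂ρ = ∑ i, ∫ x, u i (x i) ∂P := by
        refine Finset.sum_congr rfl fun i _ => ?_
        have := (hu i).aestronglyMeasurable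
        rw [← hP i] at this
        rw [← integral_map (measurable_pi_apply i).aemeasurable this, hP i]
    _ = ∫ x, ∑ i, u i (x i) ∂P := (integral_finsetSum _ fun i _ => hint i).symm
    _ ≤ _ := integral_mono_ae (integrable_finsetSum _ fun i _ => hint i) hc hle

/-- A product of conditioned measures is a multiple of the restriction of the product measure to a
box. -/
theorem pi_cond_eq_smul_restrict {ι Ω : Type*} [Fintype ι] [MeasurableSpace Ω] (ρ : Measure Ω)
    [IsProbabilityMeasure ρ] {B : ι → Set Ω} (hB : ∀ i, MeasurableSet (B i)) :
    Measure.pi (fun i => ProbabilityTheory.cond ρ (B i)) =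
      (∏ i, (ρ (B i))⁻¹) • (Measure.pi fun _ : ι => ρ).restrict (Set.univ.pi B) := by
  refine Measure.pi_eq fun s hs => ?_
  rw [Measure.smul_apply, Measure.restrict_apply (MeasurableSet.univ_pi hs),
    ← Set.pi_inter_distrib, Measure.pi_pi, smul_eq_mul, ← Finset.prod_mul_distrib]
  exact Finset.prod_congr rfl fun i _ => by rw [ProbabilityTheory.cond_apply (hB i), Set.inter_comm]

/-- A coupling of the laws of finitely-valued maps lifts to a coupling of the underlying measure,
absolutely continuous with respect to the product measure. -/
theorem exists_coupling_of_finite_weights {ι Ω X : Type*} [Fintype ι] [DecidableEq ι] [Nonempty ι]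
    [MeasurableSpace Ω]
    [Fintype X] [DecidableEq X] [MeasurableSpace X] [MeasurableSingletonClass X]
    (ρ : Measure Ω) [IsProbabilityMeasure ρ] {φ : ι → Ω → X} (hφ : ∀ j, Measurable (φ j))
    {p : (ι → X) → ℝ} (hp : ∀ s, 0 ≤ p s)
    (hmarg : ∀ j x, ∑ s, p s * (if s j = x then 1 else 0) = ρ.real (φ j ⁻¹' {x})) :
    ∃ P : Measure (ι → Ω), IsProbabilityMeasure P ∧ (∀ i, P.map (fun x => x i) = ρ) ∧
      P ≪ Measure.pi (fun _ : ι => ρ) ∧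
      ∀ C : (ι → X) → ℝ, ∫ x, C (fun j => φ j (x j)) ∂P = ∑ s, p s * C s := by
  let B : (ι → X) → ι → Set Ω := fun s j => φ j ⁻¹' {s j}
  have hB : ∀ s j, MeasurableSet (B s j) := fun s j => hφ j (measurableSet_singleton _)
  let Q : (ι → X) → Measure (ι → Ω) :=
    fun s => Measure.pi fun j => ProbabilityTheory.cond ρ (B s j)
  let P : Measure (ι → Ω) := ∑ s, ENNReal.ofReal (p s) • Q s
  have hpos : ∀ s, p s ≠ 0 → ∀ j, ρ (B s j) ≠ 0 := by
    intro s hs j h0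
    have h1 : ρ.real (φ j ⁻¹' {s j}) = 0 := by
      rw [Measure.real, show ρ (φ j ⁻¹' {s j}) = 0 from h0, ENNReal.toReal_zero]
    rw [← hmarg, Finset.sum_eq_zero_iff_of_nonneg fun t _ =>
      mul_nonneg (hp t) (by split_ifs <;> norm_num)] at h1
    exact hs (by simpa using h1 s (Finset.mem_univ s))
  have hprob : ∀ s, p s ≠ 0 → ∀ j, IsProbabilityMeasure (ProbabilityTheory.cond ρ (B s j)) :=
    fun s hs j => ProbabilityTheory.cond_isProbabilityMeasure (hpos s hs j)
  have hmap : ∀ s j, (ENNReal.ofReal (p s) • Q s).map (fun x => x j) =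
      ENNReal.ofReal (p s) • ProbabilityTheory.cond ρ (B s j) := by
    intro s j
    by_cases hs : p s = 0
    · simp [hs]
    · have := hprob s hs
      rw [Measure.map_smul]
      congr 1
      exact (measurePreserving_eval (fun j => ProbabilityTheory.cond ρ (B s j)) j).map_eq
  have hmass : ∀ j x, ρ (φ j ⁻¹' {x}) = ∑ s, if s j = x then ENNReal.ofReal (p s) else 0 := by
    intro j x
    rw [← ofReal_measureReal, ← hmarg, ENNReal.ofReal_sum_of_nonneg fun t _ =>
      mul_nonneg (hp t) (by split_ifs <;> norm_num)]
    exact Finset.sum_congr rfl fun s _ => by split_ifs <;> simp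
  have hPmap : ∀ j, P.map (fun x => x j) = ρ := by
    intro j
    rw [← Measure.mapₗ_apply_of_measurable (measurable_pi_apply j), map_sum]
    simp_rw [Measure.mapₗ_apply_of_measurable (measurable_pi_apply j), hmap]
    conv_rhs => rw [← ProbabilityTheory.sum_meas_smul_cond_fiber (hφ j) ρ]
    simp_rw [hmass, Finset.sum_smul]
    rw [Finset.sum_comm]
    refine Finset.sum_congr rfl fun s _ => ?_
    rw [Finset.sum_eq_single (s j) (fun x _ hx => by simp [hx.symm]) (by simp)]
    simp [B]
  have hPprob : IsProbabilityMeasure P := by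
    obtain ⟨j⟩ := ‹Nonempty ι›
    refine ⟨?_⟩
    have := congrArg (fun μ : Measure Ω => μ Set.univ) (hPmap j)
    simpa [Measure.map_apply (measurable_pi_apply j) MeasurableSet.univ] using this
  have hfin : ∀ C : (ι → X) → ℝ, Integrable (fun x : ι → Ω => C (fun j => φ j (x j))) P := by
    intro C
    have hm : Measurable fun x : ι → Ω => C (fun j => φ j (x j)) :=
      (measurable_of_finite C).comp
        (measurable_pi_lambda _ fun j => (hφ j).comp (measurable_pi_apply j))
    refine Integrable.of_bound hm.aestronglyMeasurable (∑ s, ‖C s‖) (ae_of_all _ fun x => ?_)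
    exact Finset.single_le_sum (f := fun s => ‖C s‖) (fun s _ => norm_nonneg _)
      (Finset.mem_univ _)
  refine ⟨P, hPprob, hPmap, ?_, fun C => ?_⟩
  · refine fun E hE => ?_
    simp only [P, Measure.coe_finsetSum, Finset.sum_apply, Measure.smul_apply, smul_eq_mul]
    refine Finset.sum_eq_zero fun s _ => ?_
    have : Q s E = 0 := by
      simp only [Q]
      rw [pi_cond_eq_smul_restrict ρ (hB s), Measure.smul_apply, smul_eq_mul,
        Measure.restrict_le_self.absolutelyContinuous hE, mul_zero]
    rw [this, mul_zero]
  · rw [integral_finsetSum_measure (integrable_finsetSum_measure.1 (hfin C))]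
    refine Finset.sum_congr rfl fun s _ => ?_
    by_cases hs : p s = 0
    · simp [hs]
    · have := hprob s hs
      have hae : ∀ᵐ x ∂Q s, C (fun j => φ j (x j)) = C s := by
        have : ∀ᵐ x ∂Q s, x ∈ Set.univ.pi (B s) := by
          simp only [Q]
          rw [pi_cond_eq_smul_restrict ρ (hB s)]
          exact Measure.ae_smul_measure (ae_restrict_mem (MeasurableSet.univ_pi (hB s))) _
        filter_upwards [this] with x hx
        congr 1
        funext j
        simpa [B] using hx j (Set.mem_univ j)
      rw [integral_smul_measure, integral_congr_ae hae]
      simp [Q, ENNReal.toReal_ofReal (hp s)]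

/-- Kantorovich duality, with attainment on both sides, for a cost that factors through
finitely-valued measurable maps of the coordinates. -/
theorem exists_optimal_coupling_and_potentials {ι Ω X : Type*} [Fintype ι] [DecidableEq ι]
    [Nonempty ι] [MeasurableSpace Ω]
    [Fintype X] [DecidableEq X] [MeasurableSpace X] [MeasurableSingletonClass X]
    (ρ : Measure Ω) [IsProbabilityMeasure ρ] {φ : ι → Ω → X} (hφ : ∀ j, Measurable (φ j))
    (C : (ι → X) → ℝ) :
    ∃ (P : Measure (ι → Ω)) (w : ι → X → ℝ),
      IsProbabilityMeasure P ∧ (∀ i, P.map (fun x => x i) = ρ) ∧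
      P ≪ Measure.pi (fun _ : ι => ρ) ∧ (∀ s, ∑ j, w j (s j) ≤ C s) ∧
      ∫ x, C (fun j => φ j (x j)) ∂P = ∑ j, ∫ y, w j (φ j y) ∂ρ := by
  let b : ι → X → ℝ := fun j x => ρ.real (φ j ⁻¹' {x})
  have hbsum : ∀ j, ∑ x, b j x = 1 := by
    intro j
    have := sum_measureReal_preimage_singleton (μ := ρ) (f := φ j) Finset.univ
      fun x _ => hφ j (measurableSet_singleton x)
    simpa [b] using this
  let F : Set ((ι → X) → ℝ) :=
    {p | (∀ s, 0 ≤ p s) ∧ ∀ j x, ∑ s, p s * (if s j = x then 1 else 0) = b j x}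
  have hne : F.Nonempty := by
    refine ⟨fun s => ∏ j, b j (s j),
      fun s => Finset.prod_nonneg fun j _ => measureReal_nonneg, fun j x => ?_⟩
    have h : ∀ s : ι → X, (∏ i, b i (s i)) * (if s j = x then 1 else 0) =
        ∏ i, b i (s i) * (if i = j then if s i = x then 1 else 0 else 1) := by
      intro s
      rw [Finset.prod_mul_distrib]
      congr 1
      simp
    simp_rw [h]
    rw [← Fintype.prod_sum (fun i y => b i y * (if i = j then if y = x then 1 else 0 else 1)),
      Finset.prod_eq_single j]
    · simp
    · intro i _ hij
      simp [hij, hbsum]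
    · simp
  have hcpt : IsCompact F := by
    refine (isCompact_univ_pi fun _ => isCompact_Icc (a := (0 : ℝ)) (b := 1)).of_isClosed_subset
      ?_ ?_
    · simp only [F, Set.ofPred_and, Set.ofPred_forall]
      refine IsClosed.inter (isClosed_iInter fun s => ?_)
        (isClosed_iInter fun j => isClosed_iInter fun x => ?_)
      · exact isClosed_le continuous_const (continuous_apply s)
      · exact isClosed_eq (by fun_prop) continuous_const
    · intro p hp s _
      refine ⟨hp.1 s, ?_⟩
      obtain ⟨j⟩ := ‹Nonempty ι›
      calc p s = p s * (if s j = s j then 1 else 0) := by simp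
        _ ≤ ∑ t, p t * (if t j = s j then 1 else 0) :=
          Finset.single_le_sum (f := fun t => p t * (if t j = s j then 1 else 0))
            (fun t _ => mul_nonneg (hp.1 t) (by split_ifs <;> norm_num)) (Finset.mem_univ s)
        _ = b j (s j) := hp.2 j (s j)
        _ ≤ 1 := measureReal_le_one
  obtain ⟨p, hpF, hmin⟩ := hcpt.exists_isMinOn hne
    (f := fun p : (ι → X) → ℝ => ∑ s, p s * C s) (by fun_prop)
  obtain ⟨w, hw, hval⟩ := exists_dual_of_isMin
    (fun (s : ι → X) (y : ι × X) => if s y.1 = y.2 then (1 : ℝ) else 0) C p hpF.1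
    fun q hq hqm => hmin ⟨hq, fun j x => (hqm (j, x)).trans (hpF.2 j x)⟩
  obtain ⟨P, hP, hPm, hPac, hPint⟩ := exists_coupling_of_finite_weights ρ hφ hpF.1 hpF.2
  refine ⟨P, fun j x => w (j, x), hP, hPm, hPac, fun s => ?_, ?_⟩
  · simpa [Fintype.sum_prod_type] using hw s
  · rw [hPint, hval, Fintype.sum_prod_type]
    refine Finset.sum_congr rfl fun j _ => ?_
    rw [← integral_map (f := fun x => w (j, x)) (hφ j).aemeasurable
      (measurable_of_finite _).aestronglyMeasurable]
    have := Measure.isProbabilityMeasure_map (μ := ρ) (hφ j).aemeasurable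
    rw [integral_fintype (Integrable.of_finite)]
    refine Finset.sum_congr rfl fun x _ => ?_
    rw [map_measureReal_apply (hφ j) (measurableSet_singleton x), smul_eq_mul, mul_comm]
    congr 1
    exact hpF.2 j x

/-- for an elementary cost (finite combination of indicators of products of
Borel sets, with the sets of each coordinate pairwise equal or disjoint) the multimarginal
Kantorovich problem over Π(ρ) and its dual have equal values, both attained, and the dual
maximizer is an N-tuple of finitely-valued (elementary) functions. -/
theorem stmt10 (N : ℕ) (hN : 2 ≤ N) (ρ : Measure E3) [IsProbabilityMeasure ρ]
    (k : ℕ) (a : Fin k → ℝ) (A : Fin k → Fin N → Set E3)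
    (hA : ∀ i j, MeasurableSet (A i j))
    (hstruct : ∀ (j : Fin N) (i i' : Fin k), A i j = A i' j ∨ Disjoint (A i j) (A i' j))
    (cn : (Fin N → E3) → ℝ)
    (hcn : ∀ x, cn x = ∑ i, a i * ∏ j, Set.indicator (A i j) (fun _ => (1 : ℝ)) (x j)) :
    ∃ (P : Measure (Fin N → E3)) (u : Fin N → E3 → ℝ),
      IsProbabilityMeasure P ∧ (∀ i : Fin N, P.map (fun x => x i) = ρ) ∧
      (∀ i, Integrable (u i) ρ) ∧ (∀ i, (Set.range (u i)).Finite) ∧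
      (∀ᵐ x ∂(Measure.pi fun _ : Fin N => ρ), ∑ i, u i (x i) ≤ cn x) ∧
      (∫ x, cn x ∂P = ∑ i, ∫ y, u i y ∂ρ) ∧
      (∀ P' : Measure (Fin N → E3), IsProbabilityMeasure P' →
        (∀ i : Fin N, P'.map (fun x => x i) = ρ) → ∫ x, cn x ∂P ≤ ∫ x, cn x ∂P') ∧
      (∀ u' : Fin N → E3 → ℝ, (∀ i, Integrable (u' i) ρ) →
        (∀ᵐ x ∂(Measure.pi fun _ : Fin N => ρ), ∑ i, u' i (x i) ≤ cn x) →
        (∑ i, ∫ y, u' i y ∂ρ) ≤ ∑ i, ∫ y, u i y ∂ρ) := by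
  classical
  have : Nonempty (Fin N) := ⟨⟨0, by omega⟩⟩
  let φ : Fin N → E3 → Fin k → Prop := fun j y i => y ∈ A i j
  have hφ : ∀ j, Measurable (φ j) := fun j => measurable_pi_lambda _ fun i => (hA i j).mem
  let C : (Fin N → Fin k → Prop) → ℝ := fun s => ∑ i, a i * ∏ j, if s j i then 1 else 0
  have hcC : cn = fun x => C (fun j => φ j (x j)) := by
    funext x
    simp only [hcn, C, φ, Set.indicator_apply]
  have hcint : ∀ P : Measure (Fin N → E3), IsProbabilityMeasure P → Integrable cn P := by
    intro P hP
    have hm : Measurable cn := hcC ▸ (measurable_of_finite C).comp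
      (measurable_pi_lambda _ fun j => (hφ j).comp (measurable_pi_apply j))
    refine Integrable.of_bound hm.aestronglyMeasurable (∑ s, ‖C s‖) (ae_of_all _ fun x => ?_)
    rw [hcC]
    exact Finset.single_le_sum (f := fun s => ‖C s‖) (fun s _ => norm_nonneg _)
      (Finset.mem_univ _)
  obtain ⟨P, w, hP, hPm, hPac, hw, hval⟩ := exists_optimal_coupling_and_potentials ρ hφ C
  have huint : ∀ i, Integrable (fun y => w i (φ i y)) ρ := fun i =>
    Integrable.of_bound ((measurable_of_finite (w i)).comp (hφ i)).aestronglyMeasurable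
      (∑ x, ‖w i x‖) (ae_of_all _ fun y =>
        Finset.single_le_sum (f := fun x => ‖w i x‖) (fun x _ => norm_nonneg _)
          (Finset.mem_univ _))
  have hle : ∀ x : Fin N → E3, ∑ i, w i (φ i (x i)) ≤ cn x := fun x => by
    rw [hcC]
    exact hw _
  have hval' : ∫ x, cn x ∂P = ∑ i, ∫ y, w i (φ i y) ∂ρ := by rw [hcC]; exact hval
  refine ⟨P, fun i y => w i (φ i y), hP, hPm, huint, fun i => ?_, ae_of_all _ hle, hval', ?_, ?_⟩
  · exact (Set.finite_range (w i)).subset (Set.range_comp_subset_range (φ i) (w i))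
  · intro P' hP' hPm'
    rw [hval']
    exact sum_integral_le_integral_of_ae_le hPm' huint (hcint P' hP') (ae_of_all _ hle)
  · intro u' hu' hle'
    rw [← hval']
    exact sum_integral_le_integral_of_ae_le hPm hu' (hcint P hP) (hPac.ae_le hle')
end
end

section
/- Let ρ be an atomless probability measure on ℝ³ and P ∈ Π(ρ) a minimizer of the multimarginal Coulomb cost. Then for every r > 0 there exists α(r) > 0 such that P(D_{α(r)} ∩ Q(r)) = 0, where D_α = {(x₁,…,x_N): |xᵢ−x_j| ≤ α for some i ≠ j} and Q(r) = {(y₁,…,y_N): maxᵢ |yᵢ| < r}. Equivalently, spt P ∩ Q(r) stays at positive distance from the diagonal set D. -/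
open MeasureTheory Filter Topology
open scoped ENNReal

noncomputable section

/-- The Coulomb cost on (ℝ³)^N, with value +∞ when two coordinates coincide. -/
def coulomb (N : ℕ) (x : Fin N → E3) : ℝ≥0∞ :=
  ∑ p ∈ Finset.univ.filter (fun p : Fin N × Fin N => p.1 < p.2),
    (ENNReal.ofReal (dist (x p.1) (x p.2)))⁻¹

theorem measurable_coulomb (N : ℕ) : Measurable (coulomb N) := by
  unfold coulomb
  fun_prop

/-- Exchanging the `i`-th coordinates of independent samples from two disjoint sets of positive
mass cannot lower the cost of a minimizer by a fixed amount. -/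
theorem not_uniform_gain_of_swap {N : ℕ} {ρ : Measure E3} [IsProbabilityMeasure ρ]
    {P : Measure (Fin N → E3)} [IsProbabilityMeasure P]
    (hmarg : ∀ i : Fin N, P.map (fun x => x i) = ρ)
    (hfin : ∫⁻ x, coulomb N x ∂P ≠ ⊤)
    (hmin : ∀ P' : Measure (Fin N → E3), IsProbabilityMeasure P' →
      (∀ i : Fin N, P'.map (fun x => x i) = ρ) →
      ∫⁻ x, coulomb N x ∂P ≤ ∫⁻ x, coulomb N x ∂P')
    (i : Fin N) {A G : Set (Fin N → E3)} (hA : MeasurableSet A) (hG : MeasurableSet G)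
    (hAG : Disjoint A G) (hPA : P A ≠ 0) (hPG : P G ≠ 0) :
    ¬ ∀ x ∈ A, ∀ y ∈ G, coulomb N (Function.update x i (y i)) +
      coulomb N (Function.update y i (x i)) + 1 ≤ coulomb N x + coulomb N y := by
  intro hgain
  set Q := (P.restrict A).prod (P.restrict G) with hQ
  set R := P.restrict (A ∪ G)ᶜ + (1 - P G) • P.restrict A + (1 - P A) • P.restrict G with hR
  let f₁ : (Fin N → E3) × (Fin N → E3) → Fin N → E3 := fun z => Function.update z.1 i (z.2 i)
  let f₂ : (Fin N → E3) × (Fin N → E3) → Fin N → E3 := fun z => Function.update z.2 i (z.1 i)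
  have hf₁ : Measurable f₁ := by
    refine measurable_pi_iff.2 fun k => ?_
    by_cases hk : k = i
    · subst hk; simp only [f₁, Function.update_self]; fun_prop
    · simp only [f₁, Function.update_of_ne hk]; fun_prop
  have hf₂ : Measurable f₂ := by
    refine measurable_pi_iff.2 fun k => ?_
    by_cases hk : k = i
    · subst hk; simp only [f₂, Function.update_self]; fun_prop
    · simp only [f₂, Function.update_of_ne hk]; fun_prop
  have hc := measurable_coulomb N
  have hdecomp : P = R + Q.map Prod.fst + Q.map Prod.snd := by
    have h1 : Q.map Prod.fst = P G • P.restrict A := by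
      rw [hQ, Measure.map_fst_prod, Measure.restrict_apply_univ]
    have h2 : Q.map Prod.snd = P A • P.restrict G := by
      rw [hQ, Measure.map_snd_prod, Measure.restrict_apply_univ]
    have h3 : (1 - P G) • P.restrict A + P G • P.restrict A = P.restrict A := by
      rw [← add_smul, tsub_add_cancel_of_le prob_le_one, one_smul]
    have h4 : (1 - P A) • P.restrict G + P A • P.restrict G = P.restrict G := by
      rw [← add_smul, tsub_add_cancel_of_le prob_le_one, one_smul]
    calc P = P.restrict (A ∪ G)ᶜ + (P.restrict A + P.restrict G) := by
          rw [← Measure.restrict_union hAG hG, Measure.restrict_compl_add_restrict (hA.union hG)]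
      _ = P.restrict (A ∪ G)ᶜ + (((1 - P G) • P.restrict A + P G • P.restrict A) +
            ((1 - P A) • P.restrict G + P A • P.restrict G)) := by rw [h3, h4]
      _ = R + Q.map Prod.fst + Q.map Prod.snd := by rw [h1, h2, hR]; abel
  set P' := R + Q.map f₁ + Q.map f₂ with hP'
  have hmarg' : ∀ k : Fin N, P'.map (fun x => x k) = ρ := by
    intro k
    have hk : Measurable fun x : Fin N → E3 => x k := measurable_pi_apply k
    rw [← hmarg k, hP']
    conv_rhs => rw [hdecomp]
    simp only [Measure.map_add _ _ hk, Measure.map_map hk hf₁, Measure.map_map hk hf₂,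
      Measure.map_map hk measurable_fst, Measure.map_map hk measurable_snd]
    by_cases hki : k = i
    · subst hki
      have e1 : (fun x : Fin N → E3 => x k) ∘ f₁ = (fun x => x k) ∘ Prod.snd := by
        ext1 z; simp [f₁]
      have e2 : (fun x : Fin N → E3 => x k) ∘ f₂ = (fun x => x k) ∘ Prod.fst := by
        ext1 z; simp [f₂]
      rw [e1, e2, add_right_comm]
    · have e1 : (fun x : Fin N → E3 => x k) ∘ f₁ = (fun x => x k) ∘ Prod.fst := by
        ext1 z; simp [f₁, hki]
      have e2 : (fun x : Fin N → E3 => x k) ∘ f₂ = (fun x => x k) ∘ Prod.snd := by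
        ext1 z; simp [f₂, hki]
      rw [e1, e2]
  have hprob : IsProbabilityMeasure P' := by
    refine ⟨?_⟩
    have h := congrArg (fun μ : Measure E3 => μ Set.univ) (hmarg' i)
    simpa [Measure.map_apply (measurable_pi_apply i) MeasurableSet.univ] using h
  have hcost : ∫⁻ x, coulomb N x ∂P' + Q Set.univ ≤ ∫⁻ x, coulomb N x ∂P := by
    have hae : ∀ᵐ z ∂Q, z ∈ A ×ˢ G := by
      rw [hQ, Measure.prod_restrict]
      exact ae_restrict_mem (hA.prod hG)
    have h : ∫⁻ z, (coulomb N (f₁ z) + coulomb N (f₂ z)) + 1 ∂Q ≤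
        ∫⁻ z, (coulomb N z.1 + coulomb N z.2) ∂Q :=
      lintegral_mono_ae (hae.mono fun z hz => hgain z.1 hz.1 z.2 hz.2)
    have hc₁ : Measurable fun z => coulomb N (f₁ z) := hc.comp hf₁
    have hc_fst : Measurable fun z : (Fin N → E3) × (Fin N → E3) => coulomb N z.1 :=
      hc.comp measurable_fst
    rw [lintegral_add_right _ measurable_const, lintegral_add_left hc₁,
      lintegral_add_left hc_fst, lintegral_one] at h
    conv_rhs => rw [hdecomp]
    have hsplit : ∀ μ ν : Measure (Fin N → E3), ∫⁻ x, coulomb N x ∂(R + μ + ν) =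
        ∫⁻ x, coulomb N x ∂ R + ∫⁻ x, coulomb N x ∂μ + ∫⁻ x, coulomb N x ∂ν := fun μ ν => by
      rw [lintegral_add_measure, lintegral_add_measure]
    rw [hP', hsplit, hsplit, lintegral_map hc hf₁, lintegral_map hc hf₂,
      lintegral_map hc measurable_fst, lintegral_map hc measurable_snd]
    simp only [add_assoc] at h ⊢
    gcongr
  have hle := hcost.trans (hmin P' hprob hmarg')
  have hfin' : ∫⁻ x, coulomb N x ∂P' ≠ ⊤ :=
    ne_top_of_le_ne_top hfin (le_self_add.trans hcost)
  have hzero : Q Set.univ = 0 := by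
    have : ∫⁻ x, coulomb N x ∂P' + Q Set.univ ≤ ∫⁻ x, coulomb N x ∂P' + 0 := by simpa using hle
    simpa using (ENNReal.add_le_add_iff_left hfin').1 this
  rw [hQ, ← Set.univ_prod_univ, Measure.prod_prod, Measure.restrict_apply_univ,
    Measure.restrict_apply_univ] at hzero
  exact (mul_ne_zero hPA hPG) hzero

/-- The part of the Coulomb cost not involving the `i`-th particle. -/
def coulombAway (N : ℕ) (i : Fin N) (x : Fin N → E3) : ℝ≥0∞ :=
  ∑ p ∈ (Finset.univ.filter (fun p : Fin N × Fin N => p.1 < p.2)).filter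
      (fun p => p.1 ≠ i ∧ p.2 ≠ i),
    (ENNReal.ofReal (dist (x p.1) (x p.2)))⁻¹

theorem coulomb_update_le {N : ℕ} (i : Fin N) (x : Fin N → E3) (a : E3) {δ : ℝ}
    (h : ∀ k, k ≠ i → δ ≤ dist a (x k)) :
    coulomb N (Function.update x i a) ≤
      coulombAway N i x + (N * N : ℕ) * (ENNReal.ofReal δ)⁻¹ := by
  unfold coulomb coulombAway
  rw [← Finset.sum_filter_add_sum_filter_not _ (fun p : Fin N × Fin N => p.1 ≠ i ∧ p.2 ≠ i)]
  refine add_le_add (Finset.sum_le_sum fun p hp => ?_) ?_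
  · obtain ⟨-, h1, h2⟩ := Finset.mem_filter.1 hp
    rw [Function.update_of_ne h1, Function.update_of_ne h2]
  · refine (Finset.sum_le_card_nsmul _ _ (ENNReal.ofReal δ)⁻¹ fun p hp => ?_).trans ?_
    · simp only [Finset.mem_filter, Finset.mem_univ, true_and] at hp
      obtain ⟨hlt, hp⟩ := hp
      refine ENNReal.inv_le_inv.2 (ENNReal.ofReal_le_ofReal ?_)
      by_cases h1 : p.1 = i
      · have h2 : p.2 ≠ i := fun h2 => hlt.ne (h1.trans h2.symm)
        rw [h1, Function.update_self, Function.update_of_ne h2]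
        exact h _ h2
      · have h2 : p.2 = i := by tauto
        rw [h2, Function.update_self, Function.update_of_ne h1, dist_comm]
        exact h _ h1
    · rw [nsmul_eq_mul]
      gcongr
      refine (Finset.card_le_univ _).trans ?_
      simp

theorem coulombAway_add_le_coulomb {N : ℕ} {i j : Fin N} (hij : i ≠ j) (x : Fin N → E3) :
    coulombAway N i x + (ENNReal.ofReal (dist (x i) (x j)))⁻¹ ≤ coulomb N x := by
  unfold coulomb coulombAway
  rw [← Finset.sum_filter_add_sum_filter_not (Finset.univ.filter _)
    (fun p : Fin N × Fin N => p.1 ≠ i ∧ p.2 ≠ i)]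
  gcongr
  rcases lt_or_gt_of_ne hij with h | h
  · exact Finset.single_le_sum (f := fun p : Fin N × Fin N =>
      (ENNReal.ofReal (dist (x p.1) (x p.2)))⁻¹) (fun _ _ => zero_le) (a := (i, j)) (by simp [h])
  · rw [dist_comm]
    exact Finset.single_le_sum (f := fun p : Fin N × Fin N =>
      (ENNReal.ofReal (dist (x p.1) (x p.2)))⁻¹) (fun _ _ => zero_le) (a := (j, i)) (by simp [h])

theorem coulombAway_le_coulomb {N : ℕ} (i : Fin N) (x : Fin N → E3) :
    coulombAway N i x ≤ coulomb N x :=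
  Finset.sum_le_sum_of_subset (Finset.filter_subset _ _)

theorem tendsto_measure_closedBall_nhdsGT_zero {X : Type*} [MetricSpace X] [MeasurableSpace X]
    [OpensMeasurableSpace X] (μ : Measure X) [IsFiniteMeasure μ] {a : X} (ha : μ {a} = 0) :
    Tendsto (fun δ : ℝ => μ (Metric.closedBall a δ)) (𝓝[>] 0) (𝓝 0) := by
  have h := tendsto_measure_biInter_gt (μ := μ) (s := fun δ : ℝ => Metric.closedBall a δ) (a := 0)
    (fun δ _ => Metric.isClosed_closedBall.nullMeasurableSet)
    (fun δ ε _ hle => Metric.closedBall_subset_closedBall hle)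
    ⟨1, one_pos, measure_ne_top _ _⟩
  have hset : ⋂ δ > (0 : ℝ), Metric.closedBall a δ = {a} := by
    ext x
    simp only [Set.mem_iInter, Metric.mem_closedBall, Set.mem_singleton_iff]
    exact ⟨fun hx => dist_le_zero.1 (le_of_forall_gt_imp_ge_of_dense hx),
      fun hx δ hδ => by simpa [hx] using hδ.le⟩
  rwa [hset, ha] at h

/-- A random configuration stays, with positive probability, at a fixed distance from a given
one, as far as the interactions with the `i`-th particle are concerned. -/
theorem measure_far_ne_zero {N : ℕ} {ρ : Measure E3}
    {P : Measure (Fin N → E3)} [IsProbabilityMeasure P]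
    (hmarg : ∀ i : Fin N, P.map (fun x => x i) = ρ) (p : Fin N → E3) {δ : ℝ}
    (hδ : ∀ k, ρ (Metric.closedBall (p k) δ) < (2 * N : ℝ≥0∞)⁻¹) (i : Fin N) :
    P {y | ∀ k, y i ∉ Metric.closedBall (p k) δ ∧ y k ∉ Metric.closedBall (p i) δ} ≠ 0 := by
  intro hzero
  have hev : ∀ k l, P {y | y k ∈ Metric.closedBall (p l) δ} < (2 * N : ℝ≥0∞)⁻¹ := by
    intro k l
    have := hδ l
    rwa [← hmarg k, Measure.map_apply (measurable_pi_apply k) measurableSet_closedBall] at this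
  have hN : (N : ℝ≥0∞) ≠ 0 := by
    have := i.pos
    exact_mod_cast this.ne'
  have hcover : (Set.univ : Set (Fin N → E3)) ⊆
      {y | ∀ k, y i ∉ Metric.closedBall (p k) δ ∧ y k ∉ Metric.closedBall (p i) δ} ∪
      ⋃ k, ({y | y i ∈ Metric.closedBall (p k) δ} ∪ {y | y k ∈ Metric.closedBall (p i) δ}) := by
    intro y _
    simp only [Set.mem_union, Set.mem_iUnion, Set.mem_ofPred_eq]
    by_contra! h
    obtain ⟨⟨k, hk⟩, h2⟩ := h
    exact (h2 k).2 (hk (h2 k).1)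
  have hlt : ∑ k : Fin N, (P {y | y i ∈ Metric.closedBall (p k) δ} +
      P {y | y k ∈ Metric.closedBall (p i) δ}) < 1 := by
    calc _ < ∑ k : Fin N, ((2 * N : ℝ≥0∞)⁻¹ + (2 * N : ℝ≥0∞)⁻¹) :=
          ENNReal.sum_lt_sum_of_nonempty ⟨i, Finset.mem_univ i⟩
            fun k _ => ENNReal.add_lt_add (hev i k) (hev k i)
      _ = (2 * N : ℝ≥0∞) * (2 * N : ℝ≥0∞)⁻¹ := by
          rw [Finset.sum_const, Finset.card_univ, Fintype.card_fin, nsmul_eq_mul]; ring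
      _ = 1 := ENNReal.mul_inv_cancel (mul_ne_zero two_ne_zero hN)
          (ENNReal.mul_ne_top (by simp) (by simp))
  have hle : (1 : ℝ≥0∞) ≤ ∑ k : Fin N, (P {y | y i ∈ Metric.closedBall (p k) δ} +
      P {y | y k ∈ Metric.closedBall (p i) δ}) := by
    calc (1 : ℝ≥0∞) = P Set.univ := measure_univ.symm
      _ ≤ _ := measure_mono hcover
      _ ≤ _ := measure_union_le _ _
      _ ≤ 0 + ∑ k : Fin N, P ({y | y i ∈ Metric.closedBall (p k) δ} ∪
            {y | y k ∈ Metric.closedBall (p i) δ}) :=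
          add_le_add hzero.le (measure_iUnion_fintype_le _ _)
      _ ≤ _ := by
          rw [zero_add]
          exact Finset.sum_le_sum fun k _ => measure_union_le _ _
  exact hle.not_gt hlt

theorem exists_nhds_measure_diagonal_strip_eq_zero {N : ℕ}
    {ρ : Measure E3} [IsProbabilityMeasure ρ] (hat : ∀ a : E3, ρ {a} = 0)
    {P : Measure (Fin N → E3)} [IsProbabilityMeasure P]
    (hmarg : ∀ i : Fin N, P.map (fun x => x i) = ρ)
    (hfin : ∫⁻ x, coulomb N x ∂P ≠ ⊤)
    (hmin : ∀ P' : Measure (Fin N → E3), IsProbabilityMeasure P' →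
      (∀ i : Fin N, P'.map (fun x => x i) = ρ) →
      ∫⁻ x, coulomb N x ∂P ≤ ∫⁻ x, coulomb N x ∂P') (p : Fin N → E3) :
    ∃ U ∈ 𝓝 p, ∃ α : ℝ, 0 < α ∧
      P ({x | ∃ i j : Fin N, i ≠ j ∧ dist (x i) (x j) ≤ α} ∩ U) = 0 := by
  obtain ⟨ε, hε, hε0⟩ : ∃ ε : ℝ, (∀ k, ρ (Metric.closedBall (p k) ε) < (2 * N : ℝ≥0∞)⁻¹) ∧
      0 < ε := by
    have h : ∀ᶠ ε : ℝ in 𝓝[>] 0, ∀ k, ρ (Metric.closedBall (p k) ε) < (2 * N : ℝ≥0∞)⁻¹ :=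
      eventually_all.2 fun k =>
        (tendsto_measure_closedBall_nhdsGT_zero ρ (hat (p k))).eventually_lt_const
          (ENNReal.inv_pos.2 (ENNReal.mul_ne_top (by simp) (by simp)))
    exact (h.and self_mem_nhdsWithin).exists
  obtain ⟨δ, hδ0, rfl⟩ : ∃ δ : ℝ, 0 < δ ∧ ε = δ + δ := ⟨ε / 2, by positivity, by ring⟩
  set M : ℝ≥0∞ := (N * N : ℕ) * (ENNReal.ofReal δ)⁻¹
  have hMtop : M + M + 1 ≠ ⊤ := by
    have : M ≠ ⊤ := ENNReal.mul_ne_top (ENNReal.natCast_ne_top _) (by simpa using hδ0)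
    simp [this]
  have hM0 : M + M + 1 ≠ 0 := by simp
  set α : ℝ := ((M + M + 1)⁻¹).toReal
  have hα0 : 0 < α := ENNReal.toReal_pos (ENNReal.inv_ne_zero.2 hMtop) (ENNReal.inv_ne_top.2 hM0)
  refine ⟨Metric.ball p δ, Metric.ball_mem_nhds p hδ0, α, hα0, ?_⟩
  have hsub : {x : Fin N → E3 | ∃ i j : Fin N, i ≠ j ∧ dist (x i) (x j) ≤ α} ∩ Metric.ball p δ ⊆
      ⋃ i, ⋃ j, {x | i ≠ j ∧ dist (x i) (x j) ≤ α} ∩ Metric.ball p δ := by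
    rintro x ⟨⟨i, j, h⟩, hx⟩
    exact Set.mem_iUnion₂.2 ⟨i, j, h, hx⟩
  refine measure_mono_null hsub (measure_iUnion_null fun i => measure_iUnion_null fun j => ?_)
  by_cases hij : i = j
  · simp [hij]
  by_contra hpos
  refine not_uniform_gain_of_swap hmarg hfin hmin i
    (G := {y | ∀ k, y i ∉ Metric.closedBall (p k) (δ + δ) ∧
      y k ∉ Metric.closedBall (p i) (δ + δ)}) ?_ ?_ ?_ hpos
    (measure_far_ne_zero hmarg p hε i) ?_
  · refine MeasurableSet.inter ?_ Metric.isOpen_ball.measurableSet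
    simp only [ne_eq, hij, not_false_eq_true, true_and]
    exact measurableSet_le (by fun_prop) measurable_const
  · simp only [Set.ofPred_forall]
    refine MeasurableSet.iInter fun k => ?_
    exact (measurable_pi_apply i measurableSet_closedBall.compl).inter
      (measurable_pi_apply k measurableSet_closedBall.compl)
  · refine Set.disjoint_left.2 fun x hx hy => (hy i).1 ?_
    have h1 : dist (x i) (p i) < δ := (dist_le_pi_dist x p i).trans_lt hx.2
    exact Metric.mem_closedBall.2 (by linarith)
  · rintro x ⟨⟨-, hxα⟩, hxp⟩ y hy
    have hx : ∀ k, dist (x k) (p k) < δ := fun k => (dist_le_pi_dist x p k).trans_lt hxp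
    have h1 := coulomb_update_le i x (y i) (δ := δ) fun k _ => by
      have h := (hy k).1
      rw [Metric.mem_closedBall, not_le] at h
      linarith [hx k, dist_triangle (y i) (x k) (p k)]
    have h2 := coulomb_update_le i y (x i) (δ := δ) fun k _ => by
      have h := (hy k).2
      rw [Metric.mem_closedBall, not_le] at h
      linarith [hx i, dist_triangle (y k) (x i) (p i), dist_comm (y k) (x i)]
    have h3 : M + M + 1 ≤ (ENNReal.ofReal (dist (x i) (x j)))⁻¹ := by
      rw [ENNReal.le_inv_iff_le_inv]
      exact ENNReal.ofReal_le_of_le_toReal hxα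
    calc _ ≤ (coulombAway N i x + M) + (coulombAway N i y + M) + 1 := by gcongr
      _ = (coulombAway N i x + (M + M + 1)) + coulombAway N i y := by ring
      _ ≤ (coulombAway N i x + (ENNReal.ofReal (dist (x i) (x j)))⁻¹) + coulombAway N i y := by
          gcongr
      _ ≤ _ := add_le_add (coulombAway_add_le_coulomb hij x) (coulombAway_le_coulomb i y)

/-- a minimizer P of the multimarginal Coulomb problem with atomless marginal
ρ avoids a strip around the diagonal inside every bounded cube: for each r > 0 there is
α(r) > 0 with P(D_{α(r)} ∩ Q(r)) = 0. -/
theorem stmt13 (N : ℕ) (hN : 2 ≤ N) (ρ : Measure E3) [IsProbabilityMeasure ρ]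
    (hat : ∀ a : E3, ρ {a} = 0)
    (P : Measure (Fin N → E3)) [IsProbabilityMeasure P]
    (hmarg : ∀ i : Fin N, P.map (fun x => x i) = ρ)
    (hfin : ∫⁻ x, coulomb N x ∂P ≠ ⊤)
    (hmin : ∀ P' : Measure (Fin N → E3), IsProbabilityMeasure P' →
      (∀ i : Fin N, P'.map (fun x => x i) = ρ) →
      ∫⁻ x, coulomb N x ∂P ≤ ∫⁻ x, coulomb N x ∂P') :
    ∀ r : ℝ, 0 < r → ∃ α : ℝ, 0 < α ∧
      P ({x : Fin N → E3 | ∃ i j : Fin N, i ≠ j ∧ dist (x i) (x j) ≤ α} ∩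
        {y : Fin N → E3 | ∀ i, ‖y i‖ < r}) = 0 := by
  intro r _
  suffices h : ∃ α : ℝ, 0 < α ∧ P ({x : Fin N → E3 | ∃ i j : Fin N, i ≠ j ∧
      dist (x i) (x j) ≤ α} ∩ Metric.closedBall 0 r) = 0 by
    obtain ⟨α, hα, h⟩ := h
    refine ⟨α, hα, measure_mono_null (Set.inter_subset_inter_right _ fun y hy => ?_) h⟩
    rw [mem_closedBall_zero_iff, pi_norm_le_iff_of_nonneg (by positivity)]
    exact fun i => (hy i).le
  refine (isCompact_closedBall (0 : Fin N → E3) r).induction_on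
    (p := fun S => ∃ α : ℝ, 0 < α ∧ P ({x : Fin N → E3 | ∃ i j : Fin N, i ≠ j ∧
      dist (x i) (x j) ≤ α} ∩ S) = 0) ⟨1, one_pos, by simp⟩ ?_ ?_ ?_
  · rintro S T hST ⟨α, hα, h⟩
    exact ⟨α, hα, measure_mono_null (Set.inter_subset_inter_right _ hST) h⟩
  · rintro S T ⟨α, hα, hS⟩ ⟨β, hβ, hT⟩
    refine ⟨min α β, lt_min hα hβ, measure_mono_null ?_ (measure_union_null hS hT)⟩
    rintro x ⟨⟨i, j, hij, hx⟩, hxS | hxT⟩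
    · exact Or.inl ⟨⟨i, j, hij, hx.trans (min_le_left _ _)⟩, hxS⟩
    · exact Or.inr ⟨⟨i, j, hij, hx.trans (min_le_right _ _)⟩, hxT⟩
  · intro p _
    obtain ⟨U, hU, h⟩ := exists_nhds_measure_diagonal_strip_eq_zero hat hmarg hfin hmin p
    exact ⟨U, mem_nhdsWithin_of_mem_nhds hU, h⟩
end
end

section
/- Let ρ be an atomless probability measure on ℝ³ (not concentrated on at most N−1 points) with finite minimal Coulomb transportation cost. Then min{∫_{(ℝ³)^N} Σ_{1≤i<j≤N} 1/|xᵢ−x_j| dP : P ∈ Π(ρ)} = sup{N∫ u dρ : u ∈ L¹(ρ), u(x₁)+⋯+u(x_N) ≤ Σ_{i<j} 1/|xᵢ−x_j| ρ^N-a.e.}, and the supremum on the right is attained by some bounded function u (a Kantorovich potential). -/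
open MeasureTheory Filter Topology
open scoped ENNReal

noncomputable section

/-- A quantitative upper bound for a discrete potential. -/
theorem discrete_potential_le {K : Type*} [Fintype K] {N : ℕ} (hN : 0 < N)
    {m : K → ℝ} (hm0 : ∀ a, 0 ≤ m a) (hm1 : ∑ a, m a = 1) {w : K → K → ℝ} {C : ℝ} (hC : 0 ≤ C)
    (hw : ∀ a, ∑ b with C < w a b, m b ≤ 1 / (4 * (N : ℝ) ^ 2))
    {v : K → ℝ}
    (hv : ∀ k : Fin N → K, ∑ i, v (k i) ≤
      ∑ p ∈ Finset.univ.filter (fun p : Fin N × Fin N => p.1 < p.2), w (k p.1) (k p.2))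
    (hmv : 0 ≤ ∑ a, m a * v a) (a : K) : v a ≤ 2 * C * (N : ℝ) ^ 2 := by
  classical
  have hNR : (1 : ℝ) ≤ N := by exact_mod_cast hN
  obtain ⟨a₀, -, ha₀⟩ := Finset.exists_max_image Finset.univ v ⟨a, Finset.mem_univ a⟩
  refine (ha₀ a (Finset.mem_univ a)).trans ?_
  set S := v a₀ with hS
  by_contra! hlt
  have hS0 : 0 < S := lt_of_le_of_lt (by positivity) hlt
  have step : ∀ T : Finset K, T.card ≤ N → ∃ b, (∀ c ∈ T, w c b ≤ C) ∧ -(S / (2 * N)) ≤ v b := by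
    intro T hT
    by_contra! hcon
    set B := Finset.univ.filter (fun b => ∃ c ∈ T, C < w c b) with hB
    have hBm : ∑ b ∈ B, m b ≤ 1 / (4 * N) := by
      calc ∑ b ∈ B, m b ≤ ∑ b, ∑ c ∈ T, if C < w c b then m b else 0 := by
            rw [hB, Finset.sum_filter]
            refine Finset.sum_le_sum fun b _ => ?_
            have hnn : ∀ c ∈ T, 0 ≤ if C < w c b then m b else 0 := fun c _ => by
              split_ifs
              exacts [hm0 b, le_rfl]
            split_ifs with h
            · obtain ⟨c, hc, hcb⟩ := h
              simpa [hcb] using Finset.single_le_sum hnn hc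
            · exact Finset.sum_nonneg hnn
        _ = ∑ c ∈ T, ∑ b with C < w c b, m b := by
            rw [Finset.sum_comm]
            simp only [Finset.sum_filter]
        _ ≤ ∑ c ∈ T, 1 / (4 * (N : ℝ) ^ 2) := Finset.sum_le_sum fun c _ => hw c
        _ = T.card * (1 / (4 * (N : ℝ) ^ 2)) := by simp
        _ ≤ N * (1 / (4 * (N : ℝ) ^ 2)) := by gcongr
        _ = 1 / (4 * N) := by field_simp
    have hsplit := Finset.sum_filter_add_sum_filter_not Finset.univ
      (fun b => ∃ c ∈ T, C < w c b) (fun b => m b * v b)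
    have hsplit1 := Finset.sum_filter_add_sum_filter_not Finset.univ
      (fun b => ∃ c ∈ T, C < w c b) m
    rw [hm1] at hsplit1
    have h2 : ∑ b ∈ B, m b * v b ≤ (∑ b ∈ B, m b) * S := by
      rw [Finset.sum_mul]
      exact Finset.sum_le_sum fun b _ =>
        mul_le_mul_of_nonneg_left (ha₀ b (Finset.mem_univ b)) (hm0 b)
    have h3 : ∑ b with ¬ ∃ c ∈ T, C < w c b, m b * v b ≤
        (∑ b with ¬ ∃ c ∈ T, C < w c b, m b) * (-(S / (2 * N))) := by
      rw [Finset.sum_mul]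
      refine Finset.sum_le_sum fun b hb => mul_le_mul_of_nonneg_left ?_ (hm0 b)
      simp only [Finset.mem_filter, Finset.mem_univ, true_and, not_exists, not_and, not_lt] at hb
      exact (hcon b hb).le
    have h4 : ∑ b with ¬ ∃ c ∈ T, C < w c b, m b = 1 - ∑ b ∈ B, m b := by linarith
    rw [h4] at h3
    have h5 : 0 ≤ (∑ b ∈ B, m b) * S + (1 - ∑ b ∈ B, m b) * (-(S / (2 * N))) := by linarith
    set t := ∑ b ∈ B, m b
    have h6 : t * (1 + 1 / (2 * N)) * S ≤ (1 / (4 * N)) * (1 + 1 / (2 * N)) * S := by gcongr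
    have h7 : (1 / (4 * (N : ℝ))) * (1 + 1 / (2 * N)) < 1 / (2 * N) := by
      have : 1 / (2 * (N : ℝ)) ≤ 1 / 2 := by gcongr; linarith
      have h0 : 0 < 1 / (4 * (N : ℝ)) := by positivity
      calc (1 / (4 * (N : ℝ))) * (1 + 1 / (2 * N)) ≤ (1 / (4 * (N : ℝ))) * (1 + 1 / 2) := by gcongr
        _ < (1 / (4 * (N : ℝ))) * 2 := by gcongr; norm_num
        _ = 1 / (2 * N) := by field_simp; norm_num
    have h8 := mul_lt_mul_of_pos_right h7 hS0
    have h9 : t * S + (1 - t) * (-(S / (2 * N))) =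
      t * (1 + 1 / (2 * N)) * S - 1 / (2 * N) * S := by field_simp; ring
    linarith
  have seq : ∀ n, n < N → ∃ k : Fin (n + 1) → K, k 0 = a₀ ∧ (∀ i j, i < j → w (k i) (k j) ≤ C) ∧
      ∀ j, -(S / (2 * N)) ≤ v (k j) := by
    intro n
    induction n with
    | zero =>
      intro _
      refine ⟨fun _ => a₀, rfl, fun i j hij => absurd hij (by omega), fun j => ?_⟩
      have : 0 ≤ S / (2 * N) := by positivity
      linarith
    | succ n ih =>
      intro hn
      obtain ⟨k, hk0, hk1, hk2⟩ := ih (by omega)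
      obtain ⟨b, hb1, hb2⟩ := step (Finset.univ.image k)
        (Finset.card_image_le.trans (by simp; omega))
      refine ⟨Fin.snoc k b, ?_, ?_, ?_⟩
      · rw [← Fin.castSucc_zero, Fin.snoc_castSucc, hk0]
      · intro i j
        induction j using Fin.lastCases with
        | last =>
          induction i using Fin.lastCases with
          | last => simp
          | cast i => intro _; simpa using hb1 (k i) (by simp)
        | cast j =>
          induction i using Fin.lastCases with
          | last => intro h; exact absurd h (by simp [Fin.le_last])
          | cast i => intro h; simpa using hk1 i j (by simpa using h)
      · intro j
        induction j using Fin.lastCases with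
        | last => simpa using hb2
        | cast j => simpa using hk2 j
  obtain ⟨n, rfl⟩ : ∃ n, N = n + 1 := ⟨N - 1, by omega⟩
  obtain ⟨k, hk0, hk1, hk2⟩ := seq n (by omega)
  have h1 := hv k
  have h2 : ∑ p ∈ Finset.univ.filter (fun p : Fin (n + 1) × Fin (n + 1) => p.1 < p.2),
      w (k p.1) (k p.2) ≤ C * ((n + 1 : ℕ) : ℝ) ^ 2 := by
    calc _ ≤ ∑ p ∈ Finset.univ.filter (fun p : Fin (n + 1) × Fin (n + 1) => p.1 < p.2), C := by
          refine Finset.sum_le_sum fun p hp => hk1 _ _ (by simpa using hp)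
      _ ≤ ∑ p : Fin (n + 1) × Fin (n + 1), C :=
          Finset.sum_le_sum_of_subset_of_nonneg (Finset.filter_subset _ _) (fun _ _ _ => hC)
      _ = _ := by simp; ring
  rw [Fin.sum_univ_succ, hk0] at h1
  have h3 : -(S / 2) ≤ ∑ i : Fin n, v (k i.succ) := by
    calc -(S / 2) ≤ n * -(S / (2 * ((n + 1 : ℕ) : ℝ))) := by
          push_cast
          have : (n : ℝ) * (S / (2 * (n + 1))) ≤ S / 2 := by
            rw [← mul_div_assoc, div_le_div_iff₀ (by positivity) (by positivity)]
            nlinarith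
          linarith
      _ = ∑ i : Fin n, -(S / (2 * ((n + 1 : ℕ) : ℝ))) := by simp
      _ ≤ _ := Finset.sum_le_sum fun i _ => hk2 _
  linarith

/-- Multimarginal duality on a finite set for a cost invariant under permutations, when
potentials may be improved to satisfy a uniform bound: primal and dual optimizers exist and
satisfy complementary slackness. -/
theorem exists_discrete_plan_potential {K : Type*} [Fintype K] [DecidableEq K]
    {N : ℕ} (hN : 0 < N)
    {m : K → ℝ} (hm0 : ∀ a, 0 ≤ m a) (hm1 : ∑ a, m a = 1) {γ : (Fin N → K) → ℝ}
    (hγ0 : ∀ k, 0 ≤ γ k) (hγ : ∀ (k : Fin N → K) (σ : Equiv.Perm (Fin N)), γ (k ∘ σ) = γ k)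
    {B : ℝ}
    (hB : ∀ v : K → ℝ, (∀ k : Fin N → K, ∑ i, v (k i) ≤ γ k) → 0 ≤ ∑ a, m a * v a →
      ∃ u : K → ℝ, (∀ k : Fin N → K, ∑ i, u (k i) ≤ γ k) ∧ (∀ a, |u a| ≤ B) ∧
        ∑ a, m a * v a ≤ ∑ a, m a * u a) :
    ∃ (p : (Fin N → K) → ℝ) (v : K → ℝ), (∀ k, 0 ≤ p k) ∧
      (∀ i a, ∑ k, p k * (if k i = a then 1 else 0) = m a) ∧
      (∀ k : Fin N → K, ∑ i, v (k i) ≤ γ k) ∧ (∀ a, |v a| ≤ B) ∧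
      ∀ k, p k ≠ 0 → γ k = ∑ i, v (k i) := by
  have hNR : (0 : ℝ) < N := by exact_mod_cast hN
  have : NeZero N := ⟨hN.ne'⟩
  set V : Set (K → ℝ) := {v | (∀ k : Fin N → K, ∑ i, v (k i) ≤ γ k) ∧ ∀ a, |v a| ≤ B} with hV
  have hVc : IsCompact V := by
    refine IsCompact.of_isClosed_subset
      (isCompact_univ_pi (fun _ : K => isCompact_Icc (a := -B) (b := B))) ?_ ?_
    · simp only [hV, Set.ofPred_and, Set.ofPred_forall]
      refine IsClosed.inter (isClosed_iInter fun k => ?_) (isClosed_iInter fun a => ?_)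
      · exact isClosed_le (by fun_prop) continuous_const
      · exact isClosed_le (by fun_prop) continuous_const
    · intro v hv a _
      exact abs_le.1 (hv.2 a)
  obtain ⟨u₀, hu₀, hu₀B, hu₀m⟩ := hB 0 (by simpa using hγ0) (by simp)
  obtain ⟨v, hvV, hvmax⟩ := hVc.exists_isMaxOn (f := fun v : K → ℝ => ∑ a, m a * v a)
    ⟨u₀, hu₀, hu₀B⟩ (by fun_prop)
  have hv0 : 0 ≤ ∑ a, m a * v a := by
    have := hvmax ⟨hu₀, hu₀B⟩
    simp only [Set.mem_ofPred_eq] at this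
    simp only [Pi.zero_apply, mul_zero, Finset.sum_const_zero] at hu₀m
    linarith
  set D := ∑ a, m a * v a with hD
  have hmaxall : ∀ v' : K → ℝ, (∀ k : Fin N → K, ∑ i, v' (k i) ≤ γ k) → ∑ a, m a * v' a ≤ D := by
    intro v' hv'
    by_contra! hlt
    obtain ⟨u, hu, huB, hum⟩ := hB v' hv' (by linarith)
    have := hvmax ⟨hu, huB⟩
    simp only [Set.mem_ofPred_eq] at this
    linarith
  let A : ((Fin N → K) → ℝ) →ₗ[ℝ] (Fin N × K → ℝ) × ℝ :=
    { toFun := fun p => (fun q => ∑ k, p k * (if k q.1 = q.2 then 1 else 0), ∑ k, p k * γ k)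
      map_add' := fun p q => by
        ext <;> simp only [Pi.add_apply, Prod.mk_add_mk, add_mul, Finset.sum_add_distrib]
      map_smul' := fun c p => by
        ext
        · simp [Finset.mul_sum]
        · simp [Finset.mul_sum, mul_assoc] }
  have key : ∃ p ∈ stdSimplex ℝ (Fin N → K), (∀ q : Fin N × K, (A p).1 q = m q.2) ∧
      (A p).2 ≤ N * D := by
    by_contra! hcon
    have hdisj : Disjoint (A '' stdSimplex ℝ (Fin N → K))
        ({fun q : Fin N × K => m q.2} ×ˢ Set.Iic (N * D)) := by
      rw [Set.disjoint_left]
      rintro _ ⟨p, hp, rfl⟩ ⟨h1, h2⟩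
      exact (hcon p hp (fun q => congrFun h1 q)).not_ge h2
    obtain ⟨f, s, t, hfs, hst, hft⟩ := geometric_hahn_banach_compact_closed
      ((convex_stdSimplex ℝ _).linear_image A)
      ((isCompact_stdSimplex ℝ (Fin N → K)).image A.continuous_of_finiteDimensional)
      ((convex_singleton _).prod (convex_Iic _)) (isClosed_singleton.prod isClosed_Iic) hdisj
    set l : Fin N × K → ℝ := fun q => f ((fun q' => if q = q' then 1 else 0), 0) with hl
    set τ := f (0, 1) with hτ
    have hf : ∀ g c, f (g, c) = ∑ q, g q * l q + c * τ := by
      intro g c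
      have h1 : (g, c) = ((g, 0) : (Fin N × K → ℝ) × ℝ) + c • ((0, 1) : (Fin N × K → ℝ) × ℝ) := by
        simp
      rw [h1, map_add, map_smul, smul_eq_mul]
      congr 1
      exact LinearMap.pi_apply_eq_sum_univ
        ((f : ((Fin N × K → ℝ) × ℝ) →ₗ[ℝ] ℝ) ∘ₗ LinearMap.inl ℝ (Fin N × K → ℝ) ℝ) g
    have hpt : ∀ k : Fin N → K, ∑ i, l (i, k i) + γ k * τ < s := by
      intro k
      have h1 := hfs _ ⟨Pi.single k 1, single_mem_stdSimplex ℝ k, rfl⟩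
      have h2 : A (Pi.single k 1) = (fun q => if k q.1 = q.2 then 1 else 0, γ k) := by
        ext <;> simp [A, Pi.single_apply, -mul_ite]
      rw [h2, hf, Fintype.sum_prod_type] at h1
      simpa using h1
    have hmt : ∀ c ≤ N * D, t < ∑ i : Fin N, ∑ a, m a * l (i, a) + c * τ := by
      intro c hc
      have h1 := hft (fun q => m q.2, c) ⟨rfl, hc⟩
      rwa [hf, Fintype.sum_prod_type] at h1
    have hdiag : ∑ i : Fin N, ∑ a, m a * l (i, a) + (∑ a, m a * γ (fun _ => a)) * τ ≤ s := by
      rw [Finset.sum_comm, Finset.sum_mul, ← Finset.sum_add_distrib]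
      calc _ ≤ ∑ a, m a * s := by
            refine Finset.sum_le_sum fun a _ => ?_
            have := mul_le_mul_of_nonneg_left (hpt fun _ => a).le (hm0 a)
            rw [← Finset.mul_sum, mul_assoc, ← mul_add]
            exact this
        _ = s := by rw [← Finset.sum_mul, hm1, one_mul]
    have hτ0 : τ < 0 := by
      by_contra! h
      have h1 := hmt (min (N * D) (∑ a, m a * γ (fun _ => a))) (min_le_left _ _)
      have h2 := mul_le_mul_of_nonneg_right
        (min_le_right (N * D) (∑ a, m a * γ (fun _ => a))) h
      linarith
    obtain ⟨σ, hσ0, hσ⟩ : ∃ σ, 0 < σ ∧ τ = -σ := ⟨-τ, by linarith, by ring⟩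
    set v' : K → ℝ := fun a => (1 / N) * ∑ j : Fin N, (l (j, a) / σ - s / (σ * N)) with hv'
    have hadm : ∀ k : Fin N → K, ∑ j, (l (j, k j) / σ - s / (σ * N)) ≤ γ k := by
      intro k
      have h1 := hpt k
      rw [hσ] at h1
      rw [Finset.sum_sub_distrib, ← Finset.sum_div]
      simp only [Finset.sum_const, Finset.card_univ, Fintype.card_fin, nsmul_eq_mul]
      have h2 : (N : ℝ) * (s / (σ * N)) = s / σ := by field_simp
      rw [h2, ← sub_div, div_le_iff₀ hσ0]
      linarith
    have hadm' : ∀ k : Fin N → K, ∑ i, v' (k i) ≤ γ k := by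
      intro k
      have h1 : ∑ i, v' (k i) =
          (1 / N) * ∑ r : Fin N, ∑ j : Fin N, (l (j, k (j + r)) / σ - s / (σ * N)) := by
        rw [hv', ← Finset.mul_sum, Finset.sum_comm, Finset.sum_comm (s := Finset.univ (α := Fin N))]
        congr 1
        rw [Finset.sum_comm]
        conv_rhs => rw [Finset.sum_comm]
        refine Finset.sum_congr rfl fun j _ => ?_
        exact (Equiv.sum_comp (Equiv.addLeft j)
          (fun i => l (j, k i) / σ - s / (σ * N))).symm
      rw [h1]
      calc _ ≤ (1 / (N : ℝ)) * ∑ r : Fin N, γ k := by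
            gcongr with r
            have := hadm (k ∘ Equiv.addRight r)
            rw [hγ] at this
            simpa using this
        _ = γ k := by simp; field_simp
    have h1 := hmaxall v' hadm'
    have h2 : ∑ a, m a * v' a = (1 / N) * ((∑ i : Fin N, ∑ a, m a * l (i, a)) / σ - s / σ) := by
      have h3 : ∀ a, m a * v' a = (1 / N) * ∑ j : Fin N, (m a * l (j, a) / σ - m a * (s / (σ * N))) := by
        intro a
        simp only [hv']
        rw [mul_left_comm, Finset.mul_sum]
        simp only [mul_sub, mul_div_assoc]
      simp only [h3]
      rw [← Finset.mul_sum, Finset.sum_comm]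
      congr 1
      simp only [Finset.sum_sub_distrib, ← Finset.sum_div, ← Finset.sum_mul, hm1]
      simp
      field_simp
    have h3 := hmt (N * D) le_rfl
    rw [hσ] at h3
    rw [h2, ← sub_div, one_div, inv_mul_le_iff₀ hNR, div_le_iff₀ hσ0] at h1
    linarith
  obtain ⟨p, hp, hpm, hpγ⟩ := key
  refine ⟨p, v, hp.1, fun i a => hpm (i, a), hvV.1, hvV.2, ?_⟩
  have hsum : ∑ k, p k * (γ k - ∑ i, v (k i)) ≤ 0 := by
    have h1 : ∑ k, p k * ∑ i, v (k i) = N * D := by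
      calc ∑ k, p k * ∑ i, v (k i) = ∑ i : Fin N, ∑ k, p k * v (k i) := by
            simp only [Finset.mul_sum]
            exact Finset.sum_comm
        _ = ∑ i : Fin N, ∑ a, (∑ k, p k * (if k i = a then 1 else 0)) * v a := by
            refine Finset.sum_congr rfl fun i _ => ?_
            simp only [Finset.sum_mul]
            rw [Finset.sum_comm]
            refine Finset.sum_congr rfl fun k _ => ?_
            simp
        _ = ∑ i : Fin N, D := by
            refine Finset.sum_congr rfl fun i _ => Finset.sum_congr rfl fun a _ => ?_
            rw [show ∑ k, p k * (if k i = a then 1 else 0) = m a from hpm (i, a)]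
        _ = N * D := by simp
    simp only [mul_sub, Finset.sum_sub_distrib]
    rw [h1]
    have : ∑ k, p k * γ k ≤ N * D := hpγ
    linarith
  have hnn : ∀ k ∈ Finset.univ, 0 ≤ p k * (γ k - ∑ i, v (k i)) := fun k _ =>
    mul_nonneg (hp.1 k) (sub_nonneg.2 (hvV.1 k))
  have hz := (Finset.sum_eq_zero_iff_of_nonneg hnn).1 (le_antisymm hsum (Finset.sum_nonneg hnn))
  intro k hk
  have := (mul_eq_zero.1 (hz k (Finset.mem_univ k))).resolve_left hk
  linarith

theorem exists_measureReal_le_norm_le {X : Type*} [NormedAddCommGroup X] [MeasurableSpace X]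
    [OpensMeasurableSpace X] (ρ : Measure X) [IsFiniteMeasure ρ] {ε : ℝ} (hε : 0 < ε) :
    ∃ r : ℝ, ρ.real {y | r ≤ ‖y‖} ≤ ε := by
  have h := tendsto_measure_iInter_atTop (μ := ρ) (s := fun n : ℕ => {y : X | (n : ℝ) ≤ ‖y‖})
    (fun n => (isClosed_le continuous_const continuous_norm).measurableSet.nullMeasurableSet)
    (fun n m hnm y (hy : (m : ℝ) ≤ ‖y‖) => le_trans (Nat.cast_le.2 hnm) hy) ⟨0, measure_ne_top _ _⟩
  have hemp : (⋂ n : ℕ, {y : X | (n : ℝ) ≤ ‖y‖}) = ∅ := by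
    ext y
    simp only [Set.mem_iInter, Set.mem_ofPred_eq, Set.mem_empty_iff_false, iff_false, not_forall,
      not_le]
    exact exists_nat_gt ‖y‖
  rw [hemp, measure_empty] at h
  obtain ⟨n, hn⟩ := (h.eventually (ge_mem_nhds (ENNReal.ofReal_pos.2 hε))).exists
  exact ⟨n, ENNReal.toReal_le_of_le_ofReal hε.le hn⟩

/-- Small balls have uniformly small mass for a finite measure without atoms. -/
theorem exists_forall_measureReal_closedBall_le {X : Type*} [NormedAddCommGroup X]
    [ProperSpace X] [MeasurableSpace X] [OpensMeasurableSpace X] (ρ : Measure X)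
    [IsFiniteMeasure ρ] (hρ : ∀ x, ρ {x} = 0) {ε : ℝ} (hε : 0 < ε) :
    ∃ δ > 0, ∀ x, ρ.real (Metric.closedBall x δ) ≤ ε := by
  obtain ⟨r, hr⟩ := exists_measureReal_le_norm_le ρ hε
  have hloc : ∀ x, ∃ s > 0, ρ.real (Metric.closedBall x s) ≤ ε := by
    intro x
    have h := tendsto_measure_iInter_atTop (μ := ρ)
      (s := fun n : ℕ => Metric.closedBall x (1 / ((n : ℝ) + 1)))
      (fun n => Metric.isClosed_closedBall.measurableSet.nullMeasurableSet)
      (fun n m hnm => Metric.closedBall_subset_closedBall (Nat.one_div_le_one_div hnm))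
      ⟨0, measure_ne_top _ _⟩
    have hsing : (⋂ n : ℕ, Metric.closedBall x (1 / ((n : ℝ) + 1))) = {x} := by
      ext y
      simp only [Set.mem_iInter, Metric.mem_closedBall, Set.mem_singleton_iff]
      refine ⟨fun hy => ?_, fun hy n => by subst hy; simp; positivity⟩
      exact dist_le_zero.1 (ge_of_tendsto' tendsto_one_div_add_atTop_nhds_zero_nat hy)
    rw [hsing, hρ] at h
    obtain ⟨n, hn⟩ := (h.eventually (ge_mem_nhds (ENNReal.ofReal_pos.2 hε))).exists
    exact ⟨1 / ((n : ℝ) + 1), by positivity, ENNReal.toReal_le_of_le_ofReal hε.le hn⟩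
  choose s hs0 hs using hloc
  obtain ⟨δ, hδ, hcov⟩ := lebesgue_number_lemma_of_metric
    (isCompact_closedBall (0 : X) (r + 1)) (fun x => Metric.isOpen_ball (x := x) (ε := s x))
    (fun x _ => Set.mem_iUnion.2 ⟨x, Metric.mem_ball_self (hs0 x)⟩)
  refine ⟨min (δ / 2) 1, by positivity, fun x => ?_⟩
  by_cases hx : x ∈ Metric.closedBall (0 : X) (r + 1)
  · obtain ⟨y, hy⟩ := hcov x hx
    refine (measureReal_mono ?_).trans (hs y)
    exact ((Metric.closedBall_subset_ball (lt_of_le_of_lt (min_le_left _ _) (half_lt_self hδ))).trans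
      hy).trans Metric.ball_subset_closedBall
  · refine (measureReal_mono ?_).trans hr
    intro y hy
    have h1 : dist y x ≤ 1 := le_trans hy (min_le_right _ _)
    simp only [mem_closedBall_zero_iff, not_le] at hx
    have h2 := norm_sub_norm_le x y
    rw [← dist_eq_norm, dist_comm] at h2
    simp only [Set.mem_ofPred_eq]
    linarith

theorem exists_simpleFunc_dist_lt {X : Type*} [MetricSpace X] [MeasurableSpace X]
    [OpensMeasurableSpace X] [SecondCountableTopology X] [Nonempty X] {s : Set X}
    (hs : IsCompact s) {h : ℝ} (hh : 0 < h) :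
    ∃ g : SimpleFunc X X, ∀ x ∈ s, dist (g x) x < h := by
  obtain ⟨t, ht⟩ := hs.elim_finite_subcover
    (fun n : ℕ => Metric.ball (TopologicalSpace.denseSeq X n) h) (fun n => Metric.isOpen_ball)
    (fun x _ => by
      obtain ⟨n, hn⟩ := (TopologicalSpace.denseRange_denseSeq X).exists_dist_lt x hh
      exact Set.mem_iUnion.2 ⟨n, hn⟩)
  refine ⟨SimpleFunc.nearestPt (TopologicalSpace.denseSeq X) (t.sup id), fun x hx => ?_⟩
  obtain ⟨n, hn, hxn⟩ := Set.mem_iUnion₂.1 (ht hx)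
  have h1 := SimpleFunc.edist_nearestPt_le (TopologicalSpace.denseSeq X) x
    (show n ≤ t.sup id from Finset.le_sup (f := id) hn)
  rw [edist_dist, edist_dist, ENNReal.ofReal_le_ofReal_iff dist_nonneg] at h1
  exact h1.trans_lt (by rwa [dist_comm])

/-- A finite partition together with a discrete pair interaction approximating the Coulomb
interaction `1 / |x - y|` from below, capped at `L`. -/
theorem exists_coulomb_discretization (ρ : Measure E3) [IsFiniteMeasure ρ] {δ ε₁ L ε : ℝ}
    (hδ : 0 < δ) (hρδ : ∀ x, ρ.real (Metric.closedBall x δ) ≤ ε₁) (hε₁ : 0 < ε₁) (hL : 0 < L)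
    (hε : 0 < ε) :
    ∃ (K : Type) (_ : Fintype K) (_ : DecidableEq K) (f : E3 → K) (w : K → K → ℝ) (R : K),
      (∀ a, MeasurableSet (f ⁻¹' {a})) ∧ (∀ a b, w a b = w b a) ∧ (∀ a b, 0 ≤ w a b) ∧
      (∀ x y, f x ≠ R → f y ≠ R → ENNReal.ofReal (w (f x) (f y)) ≤ (ENNReal.ofReal (dist x y))⁻¹) ∧
      (∀ x y, w (f x) (f y) < L →
        (ENNReal.ofReal (dist x y))⁻¹ ≤ ENNReal.ofReal (w (f x) (f y) + ε)) ∧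
      ρ.real (f ⁻¹' {R}) ≤ ε ∧
      ∀ a, ∑ b with 1 / δ < w a b, ρ.real (f ⁻¹' {b}) ≤ 2 * ε₁ := by
  classical
  obtain ⟨r, hr⟩ := exists_measureReal_le_norm_le ρ (lt_min hε hε₁)
  set q := 1 / L with hq
  have hq0 : 0 < q := by positivity
  set h := min (q / 8) (ε * q ^ 2 / 8) with hh
  have hh0 : 0 < h := by positivity
  have hhq : 8 * h ≤ q := by have := min_le_left (q / 8) (ε * q ^ 2 / 8); linarith
  have hhε : 8 * h ≤ ε * q ^ 2 := by have := min_le_right (q / 8) (ε * q ^ 2 / 8); linarith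
  set r₁ := r + h with hr₁
  set r₂ := r₁ + h + 1 / ε with hr₂
  have hr₂r : r ≤ r₂ := by have : 0 < 1 / ε := by positivity
                           linarith
  obtain ⟨g, hg⟩ := exists_simpleFunc_dist_lt (isCompact_closedBall (0 : E3) r₂) hh0
  let f : E3 → Option g.range := fun x =>
    if ‖x‖ ≤ r₂ then some ⟨g x, g.mem_range_self x⟩ else none
  have hf_none : ∀ x, f x = none ↔ r₂ < ‖x‖ := by
    intro x; simp [f]
  have hf_some : ∀ x b, f x = some b → ‖x‖ ≤ r₂ ∧ dist (b : E3) x < h := by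
    intro x b hx
    by_cases hxr : ‖x‖ ≤ r₂
    · simp only [f, hxr, if_true, Option.some.injEq] at hx
      subst hx
      exact ⟨hxr, hg x (by simpa using hxr)⟩
    · simp [f, hxr] at hx
  let w : Option g.range → Option g.range → ℝ
    | some a, some b => (max (dist (a : E3) b + 2 * h) q)⁻¹
    | none, some b => if r₁ ≤ ‖(b : E3)‖ then L else 0
    | some b, none => if r₁ ≤ ‖(b : E3)‖ then L else 0
    | none, none => L
  have hwsymm : ∀ a b, w a b = w b a := by
    rintro (_ | a) (_ | b) <;> simp [w, dist_comm]
  have hmeas : ∀ a, MeasurableSet (f ⁻¹' {a}) := by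
    rintro (_ | b)
    · have : f ⁻¹' {none} = {x | r₂ < ‖x‖} := by ext x; simp [hf_none]
      rw [this]
      exact measurableSet_lt measurable_const measurable_norm
    · have : f ⁻¹' {some b} = {x | ‖x‖ ≤ r₂} ∩ g ⁻¹' {(b : E3)} := by
        ext x
        simp [f, Subtype.ext_iff]
      rw [this]
      exact (measurableSet_le measurable_norm measurable_const).inter (g.measurableSet_fiber _)
  refine ⟨Option g.range, inferInstance, inferInstance, f, w, none, hmeas, hwsymm, ?_, ?_, ?_, ?_, ?_⟩
  · rintro (_ | a) (_ | b)
    · exact hL.le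
    · simp only [w]; split_ifs <;> positivity
    · simp only [w]; split_ifs <;> positivity
    · simp only [w]; positivity
  · intro x y hx hy
    obtain ⟨a, ha⟩ := Option.ne_none_iff_exists'.1 hx
    obtain ⟨b, hb⟩ := Option.ne_none_iff_exists'.1 hy
    obtain ⟨-, hax⟩ := hf_some x a ha
    obtain ⟨-, hby⟩ := hf_some y b hb
    rw [ha, hb]
    simp only [w]
    rw [ENNReal.ofReal_inv_of_pos (by positivity), ENNReal.inv_le_inv]
    refine ENNReal.ofReal_le_ofReal (le_max_of_le_left ?_)
    have h1 := dist_triangle4 x (a : E3) b y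
    have h2 := dist_comm x (a : E3)
    linarith
  · have far : ∀ x y b, r₂ < ‖x‖ → f y = some b → ‖(b : E3)‖ < r₁ →
        (ENNReal.ofReal (dist x y))⁻¹ ≤ ENNReal.ofReal ε := by
      intro x y b hx hy hb
      obtain ⟨-, hby⟩ := hf_some y b hy
      have h1 : 1 / ε ≤ dist x y := by
        have h2 := norm_sub_norm_le x y
        have h3 := norm_sub_norm_le y (b : E3)
        rw [← dist_eq_norm] at h2 h3
        rw [dist_comm] at h3
        linarith
      have h2 : 0 < 1 / ε := by positivity
      rw [← ENNReal.ofReal_inv_of_pos (h2.trans_le h1)]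
      refine ENNReal.ofReal_le_ofReal (inv_le_of_inv_le₀ hε ?_)
      simpa using h1
    intro x y hw
    rcases ha : f x with _ | a <;> rcases hb : f y with _ | b <;> rw [ha, hb] at hw
    · exact absurd hw (lt_irrefl _)
    · have hbr : ‖(b : E3)‖ < r₁ := by
        by_contra! hcon
        simp [w, hcon] at hw
      have h1 := far x y b ((hf_none x).1 ha) hb hbr
      simpa [w, hbr.not_ge] using h1
    · have hbr : ‖(a : E3)‖ < r₁ := by
        by_contra! hcon
        simp [w, hcon] at hw
      have h1 := far y x a ((hf_none y).1 hb) ha hbr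
      rw [dist_comm]
      simpa [w, hbr.not_ge] using h1
    · obtain ⟨-, hax⟩ := hf_some x a ha
      obtain ⟨-, hby⟩ := hf_some y b hb
      simp only [w] at hw ⊢
      set d := dist (a : E3) b + 2 * h with hd
      have hdq : q < d := by
        by_contra! hcon
        rw [max_eq_right hcon, hq] at hw
        simp at hw
      rw [max_eq_left hdq.le]
      have h1 := dist_triangle4 (a : E3) x y b
      have h1' := dist_comm y (b : E3)
      have h2 : d - 4 * h ≤ dist x y := by linarith
      have h3 : 0 < d - 4 * h := by linarith
      have hd0 : 0 < d := by linarith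
      rw [← ENNReal.ofReal_inv_of_pos (h3.trans_le h2)]
      refine ENNReal.ofReal_le_ofReal ((inv_anti₀ h3 h2).trans ?_)
      rw [inv_le_iff_one_le_mul₀ h3]
      have h4 : (d⁻¹ + ε) * (d - 4 * h) = 1 + (ε * d * (d - 4 * h) - 4 * h) / d := by
        field_simp
        ring
      rw [h4]
      have h5 : ε * q ^ 2 ≤ ε * d * (2 * (d - 4 * h)) := by
        rw [mul_assoc]
        gcongr
        nlinarith
      have : 0 ≤ (ε * d * (d - 4 * h) - 4 * h) / d := by
        apply div_nonneg _ hd0.le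
        linarith
      linarith
  · refine (measureReal_mono ?_).trans (hr.trans (min_le_left _ _))
    intro x hx
    exact hr₂r.trans ((hf_none x).1 hx).le
  · have hr' : ρ.real {y | r ≤ ‖y‖} ≤ ε₁ := hr.trans (min_le_right _ _)
    intro a
    rw [sum_measureReal_preimage_singleton _ (fun b _ => hmeas b)]
    rcases a with _ | a
    · refine (measureReal_mono ?_).trans (hr'.trans (by linarith))
      intro y hy
      simp only [Finset.coe_filter, Finset.mem_univ, true_and, Set.mem_preimage,
        Set.mem_ofPred_eq] at hy
      rcases hb : f y with _ | b
      · exact hr₂r.trans ((hf_none y).1 hb).le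
      · rw [hb] at hy
        obtain ⟨-, hby⟩ := hf_some y b hb
        have hbr : r₁ ≤ ‖(b : E3)‖ := by
          by_contra! hcon
          simp only [w, hcon.not_ge, if_false] at hy
          exact hy.not_ge (by positivity)
        have h3 := norm_sub_norm_le (b : E3) y
        rw [← dist_eq_norm] at h3
        simp only [Set.mem_ofPred_eq]
        linarith
    · have hsub : f ⁻¹' ↑(Finset.univ.filter (fun b => 1 / δ < w (some a) b)) ⊆
          Metric.closedBall (a : E3) δ ∪ {y | r ≤ ‖y‖} := by
        intro y hy
        simp only [Finset.coe_filter, Finset.mem_univ, true_and, Set.mem_preimage,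
          Set.mem_ofPred_eq] at hy
        rcases hb : f y with _ | b
        · exact Or.inr (hr₂r.trans ((hf_none y).1 hb).le)
        · left
          rw [hb] at hy
          obtain ⟨-, hby⟩ := hf_some y b hb
          simp only [w] at hy
          rw [one_div, inv_lt_inv₀ hδ (by positivity)] at hy
          have h1 := (le_max_left _ _).trans_lt hy
          have h2 := dist_triangle y (b : E3) a
          have h3 := dist_comm y (b : E3)
          have h4 := dist_comm (b : E3) a
          simp only [Metric.mem_closedBall]
          linarith
      have := (measureReal_mono hsub (μ := ρ)).trans (measureReal_union_le _ _)
      have h2 := hρδ a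
      linarith

/-- A discrete plan, spread out proportionally to the reference measure inside each cell. -/
theorem exists_coupling_of_discrete_plan {X : Type*} [MeasurableSpace X] (ρ : Measure X)
    [IsProbabilityMeasure ρ] {K : Type*} [Fintype K] [DecidableEq K] {f : X → K}
    (hf : ∀ a, MeasurableSet (f ⁻¹' {a})) {N : ℕ} (hN : 0 < N) {p : (Fin N → K) → ℝ}
    (hp0 : ∀ k, 0 ≤ p k)
    (hpm : ∀ i a, ∑ k, p k * (if k i = a then 1 else 0) = ρ.real (f ⁻¹' {a})) :
    ∃ P : Measure (Fin N → X), IsProbabilityMeasure P ∧ (∀ i, P.map (fun x => x i) = ρ) ∧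
      ∀ (c : (Fin N → X) → ℝ≥0∞) (b : (Fin N → K) → ℝ≥0∞),
        (∀ x, p (f ∘ x) ≠ 0 → c x ≤ b (f ∘ x)) →
          ∫⁻ x, c x ∂P ≤ ∑ k, ENNReal.ofReal (p k) * b k := by
  have hpos : ∀ k, p k ≠ 0 → ∀ i, ρ (f ⁻¹' {k i}) ≠ 0 := by
    intro k hk i h0
    have h1 := hpm i (k i)
    rw [measureReal_def, h0, ENNReal.toReal_zero,
      Finset.sum_eq_zero_iff_of_nonneg
        (fun j _ => mul_nonneg (hp0 j) (by split_ifs <;> norm_num))] at h1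
    have h2 := h1 k (Finset.mem_univ k)
    simp at h2
    exact hk h2
  let Q : (Fin N → K) → Measure (Fin N → X) :=
    fun k => Measure.pi (fun i => ProbabilityTheory.cond ρ (f ⁻¹' {k i}))
  have hQ : ∀ k, p k ≠ 0 → ∀ i, MeasurePreserving (fun x => x i) (Q k)
      (ProbabilityTheory.cond ρ (f ⁻¹' {k i})) := by
    intro k hk i
    have : ∀ i, IsProbabilityMeasure (ProbabilityTheory.cond ρ (f ⁻¹' {k i})) :=
      fun i => ProbabilityTheory.cond_isProbabilityMeasure (hpos k hk i)
    exact measurePreserving_eval (fun i => ProbabilityTheory.cond ρ (f ⁻¹' {k i})) i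
  let P : Measure (Fin N → X) := ∑ k, ENNReal.ofReal (p k) • Q k
  have hmap : ∀ i, P.map (fun x => x i) = ρ := by
    intro i
    ext s hs
    have hQs : ∀ k, (ENNReal.ofReal (p k) • Q k) ((fun x => x i) ⁻¹' s) =
        ∑ a, ENNReal.ofReal (p k * (if k i = a then 1 else 0)) *
          ProbabilityTheory.cond ρ (f ⁻¹' {a}) s := by
      intro k
      rw [Finset.sum_eq_single (k i)]
      · simp only [Measure.smul_apply, smul_eq_mul, if_true, mul_one]
        by_cases hk : p k = 0
        · simp [hk]
        · rw [(hQ k hk i).measure_preimage hs.nullMeasurableSet]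
      · intro b _ hb
        rw [if_neg (Ne.symm hb)]
        simp
      · simp
    rw [Measure.map_apply (measurable_pi_apply i) hs, Measure.finsetSum_apply]
    simp_rw [hQs]
    rw [Finset.sum_comm]
    simp_rw [← Finset.sum_mul]
    have : ∀ a, (∑ k, ENNReal.ofReal (p k * (if k i = a then 1 else 0))) *
        ProbabilityTheory.cond ρ (f ⁻¹' {a}) s = ρ.restrict s (f ⁻¹' {a}) := by
      intro a
      rw [← ENNReal.ofReal_sum_of_nonneg
        (fun j _ => mul_nonneg (hp0 j) (by split_ifs <;> norm_num)), hpm, mul_comm,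
        ofReal_measureReal, ProbabilityTheory.cond_mul_eq_inter (hf a),
        Measure.restrict_apply (hf a)]
    simp_rw [this]
    rw [sum_measure_preimage_singleton _ (fun a _ => hf a)]
    simp
  refine ⟨P, ⟨?_⟩, hmap, ?_⟩
  · have h := congrArg (fun μ : Measure X => μ Set.univ) (hmap ⟨0, hN⟩)
    simpa [Measure.map_apply (measurable_pi_apply _) MeasurableSet.univ] using h
  · intro c b hcb
    rw [lintegral_finsetSum_measure]
    refine Finset.sum_le_sum fun k _ => ?_
    rw [lintegral_smul_measure, smul_eq_mul]
    by_cases hk : p k = 0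
    · simp [hk]
    refine mul_le_mul_right ?_ _
    have : ∀ i, IsProbabilityMeasure (ProbabilityTheory.cond ρ (f ⁻¹' {k i})) :=
      fun i => ProbabilityTheory.cond_isProbabilityMeasure (hpos k hk i)
    have hae : ∀ᵐ x ∂(Q k), ∀ i, f (x i) = k i := by
      rw [ae_all_iff]
      intro i
      exact (hQ k hk i).quasiMeasurePreserving.ae (ProbabilityTheory.ae_cond_mem (hf (k i)))
    calc ∫⁻ x, c x ∂(Q k) ≤ ∫⁻ _, b k ∂(Q k) := by
          refine lintegral_mono_ae ?_
          filter_upwards [hae] with x hx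
          have hfx : f ∘ x = k := funext hx
          have := hcb x (by rwa [hfx])
          rwa [hfx] at this
      _ = b k := by simp [Q]

theorem continuous_coulomb (N : ℕ) : Continuous (coulomb N) := by
  unfold coulomb
  refine continuous_finsetSum _ fun p _ => ?_
  refine continuous_inv.comp (ENNReal.continuous_ofReal.comp ?_)
  exact (continuous_apply p.1).dist (continuous_apply p.2)

/-- An inequality between a separable sum and a continuous cost which holds almost everywhere for
the product measure holds at every point all of whose coordinates avoid a suitable null set. -/
theorem ae_forall_ofReal_sum_le_of_ae_pi {X : Type*} [TopologicalSpace X]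
    [SecondCountableTopology X] [MeasurableSpace X] [BorelSpace X] {ρ : Measure X}
    [IsFiniteMeasure ρ] {N : ℕ} {c : (Fin N → X) → ℝ≥0∞} (hc : Continuous c) {v : X → ℝ}
    (hv : Measurable v)
    (h : ∀ᵐ x ∂(Measure.pi fun _ : Fin N => ρ), ENNReal.ofReal (∑ i, v (x i)) ≤ c x) :
    ∃ G : Set X, (∀ᵐ y ∂ρ, y ∈ G) ∧
      ∀ x : Fin N → X, (∀ i, x i ∈ G) → ENNReal.ofReal (∑ i, v (x i)) ≤ c x := by
  have hm : ∀ q : ℚ, MeasurableSet {z | (q : ℝ) < v z} := fun q =>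
    measurableSet_lt measurable_const hv
  refine ⟨{y | ∀ q : ℚ, (q : ℝ) < v y → y ∈ (ρ.restrict {z | (q : ℝ) < v z}).support}, ?_, ?_⟩
  · simp only [Set.mem_ofPred_eq]
    rw [ae_all_iff]
    intro q
    exact (ae_restrict_iff' (hm q)).1 (Measure.support_mem_ae (μ := ρ.restrict {z | (q : ℝ) < v z}))
  intro x hx
  by_contra hlt
  rw [not_le] at hlt
  have htop : c x ≠ ⊤ := hlt.ne_top
  have hlt' : (c x).toReal < ∑ i, v (x i) := by
    rwa [ENNReal.lt_ofReal_iff_toReal_lt htop] at hlt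
  have hN : 0 < N := by
    rcases Nat.eq_zero_or_pos N with rfl | hN
    · simp at hlt
    · exact hN
  have hNr : (0 : ℝ) < N := by exact_mod_cast hN
  set t : ℝ := (∑ i, v (x i) - (c x).toReal) / N with ht
  have htpos : 0 < t := div_pos (by linarith) hNr
  choose q hq1 hq2 using fun i => exists_rat_btwn (show v (x i) - t < v (x i) by linarith)
  have hqs : (c x).toReal < ∑ i, (q i : ℝ) := by
    have hne : (Finset.univ : Finset (Fin N)).Nonempty := ⟨⟨0, hN⟩, Finset.mem_univ _⟩
    have h1 : ∑ i, (v (x i) - t) < ∑ i, (q i : ℝ) :=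
      Finset.sum_lt_sum_of_nonempty hne fun i _ => hq1 i
    have h2 : ∑ i : Fin N, (v (x i) - t) = (c x).toReal := by
      rw [Finset.sum_sub_distrib, Finset.sum_const, Finset.card_univ, Fintype.card_fin,
        nsmul_eq_mul, ht]
      field_simp
      ring
    linarith
  have hnear : {y | c y < ENNReal.ofReal (∑ i, (q i : ℝ))} ∈ 𝓝 x := by
    refine hc.continuousAt.eventually_lt continuousAt_const ?_
    rwa [ENNReal.lt_ofReal_iff_toReal_lt htop]
  rw [nhds_pi, Filter.mem_pi] at hnear
  obtain ⟨I, -, U, hU, hUs⟩ := hnear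
  have hpos : (Measure.pi fun _ : Fin N => ρ)
      (Set.univ.pi fun i => U i ∩ {z | (q i : ℝ) < v z}) ≠ 0 := by
    rw [Measure.pi_pi]
    refine Finset.prod_ne_zero_iff.2 fun i _ => ?_
    have := (Measure.mem_support_iff_forall _).1 (hx i (q i) (hq2 i)) (U i) (hU i)
    rw [Measure.restrict_apply' (hm (q i))] at this
    exact this.ne'
  obtain ⟨y, hy, hyc⟩ := ((frequently_ae_mem_iff.2 hpos).and_eventually h).exists
  have hyU : c y < ENNReal.ofReal (∑ i, (q i : ℝ)) := hUs fun i _ => (hy i trivial).1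
  refine (hyc.trans_lt hyU).not_ge (ENNReal.ofReal_le_ofReal ?_)
  exact Finset.sum_le_sum fun i _ => (hy i trivial).2.le

theorem ofReal_integral_le_lintegral_ofReal {X : Type*} [MeasurableSpace X] {μ : Measure X}
    {g : X → ℝ} (hg : Integrable g μ) :
    ENNReal.ofReal (∫ x, g x ∂μ) ≤ ∫⁻ x, ENNReal.ofReal (g x) ∂μ := by
  rw [integral_eq_lintegral_pos_part_sub_lintegral_neg_part hg]
  refine (ENNReal.ofReal_le_ofReal (sub_le_self _ ENNReal.toReal_nonneg)).trans ?_
  exact ENNReal.ofReal_toReal_le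

theorem integrable_sum_comp_eval {X : Type*} [MeasurableSpace X] {ρ : Measure X} {N : ℕ}
    {P : Measure (Fin N → X)} (hP : ∀ i, P.map (fun x => x i) = ρ) {v : X → ℝ}
    (hv : Integrable v ρ) :
    Integrable (fun x => ∑ i, v (x i)) P ∧ ∫ x, ∑ i, v (x i) ∂P = N * ∫ y, v y ∂ρ := by
  have hi : ∀ i, Integrable (fun x : Fin N → X => v (x i)) P := fun i =>
    Integrable.comp_measurable (f := fun x : Fin N → X => x i) (by rwa [hP i])
      (measurable_pi_apply i)
  refine ⟨integrable_finsetSum _ fun i _ => hi i, ?_⟩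
  rw [integral_finsetSum _ fun i _ => hi i]
  have : ∀ i, ∫ x, v (x i) ∂P = ∫ y, v y ∂ρ := by
    intro i
    have := integral_map (μ := P) (φ := fun x : Fin N → X => x i) (f := v)
      (measurable_pi_apply i).aemeasurable (by rw [hP i]; exact hv.1)
    rw [← this, hP i]
  simp [this]

/-- Weak duality for the multimarginal problem with a continuous cost. -/
theorem ofReal_integral_le_lintegral_of_ae_pi {X : Type*} [TopologicalSpace X]
    [SecondCountableTopology X] [MeasurableSpace X] [BorelSpace X] {ρ : Measure X}
    [IsFiniteMeasure ρ] {N : ℕ} {c : (Fin N → X) → ℝ≥0∞} (hc : Continuous c) {v : X → ℝ}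
    (hv : Integrable v ρ)
    (h : ∀ᵐ x ∂(Measure.pi fun _ : Fin N => ρ), ENNReal.ofReal (∑ i, v (x i)) ≤ c x)
    {P : Measure (Fin N → X)} (hP : ∀ i, P.map (fun x => x i) = ρ) :
    ENNReal.ofReal (N * ∫ y, v y ∂ρ) ≤ ∫⁻ x, c x ∂P := by
  obtain ⟨v', hv', hvv'⟩ := hv.1.aemeasurable
  have hvi : Integrable v' ρ := hv.congr hvv'
  have h' : ∀ᵐ x ∂(Measure.pi fun _ : Fin N => ρ), ENNReal.ofReal (∑ i, v' (x i)) ≤ c x := by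
    have hall : ∀ᵐ x ∂(Measure.pi fun _ : Fin N => ρ), ∀ i, v (x i) = v' (x i) := by
      rw [ae_all_iff]
      exact fun i => (Measure.quasiMeasurePreserving_eval (μ := fun _ : Fin N => ρ) i).ae hvv'
    filter_upwards [h, hall] with x hx hxi
    simpa [hxi] using hx
  obtain ⟨G, hG, hGc⟩ := ae_forall_ofReal_sum_le_of_ae_pi hc hv' h'
  have hPG : ∀ᵐ x ∂P, ∀ i, x i ∈ G := by
    rw [ae_all_iff]
    intro i
    exact ae_of_ae_map (measurable_pi_apply i).aemeasurable (by rwa [hP i])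
  obtain ⟨hgi, heq⟩ := integrable_sum_comp_eval hP hvi
  rw [integral_congr_ae hvv', ← heq]
  refine (ofReal_integral_le_lintegral_ofReal hgi).trans (lintegral_mono_ae ?_)
  filter_upwards [hPG] with x hx using hGc x hx

/-- A decreasing sequence of nonempty closed convex sets in a Hilbert space, the first of which is
bounded, has a common point. -/
theorem exists_forall_mem_of_antitone_isClosed_convex {H : Type*} [NormedAddCommGroup H]
    [InnerProductSpace ℝ H] [CompleteSpace H] {S : ℕ → Set H} (hS : Antitone S)
    (hne : ∀ n, (S n).Nonempty) (hcl : ∀ n, IsClosed (S n)) (hcv : ∀ n, Convex ℝ (S n))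
    {R : ℝ} (hR : ∀ x ∈ S 0, ‖x‖ ≤ R) : ∃ x, ∀ n, x ∈ S n := by
  choose x hxS hx using fun n =>
    exists_norm_eq_iInf_of_complete_convex (hne n) (hcl n).isComplete (hcv n) 0
  have hmin : ∀ n, ∀ y ∈ S n, ‖x n‖ ≤ ‖y‖ := by
    intro n y hy
    have h1 := hx n
    simp only [zero_sub, norm_neg] at h1
    rw [h1]
    exact ciInf_le ⟨0, by rintro _ ⟨z, rfl⟩; exact norm_nonneg _⟩ (⟨y, hy⟩ : S n)
  have hmono : Monotone fun n => ‖x n‖ := fun m n hmn => hmin m _ (hS hmn (hxS n))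
  have hbdd : BddAbove (Set.range fun n => ‖x n‖) := by
    refine ⟨R, ?_⟩
    rintro _ ⟨n, rfl⟩
    exact hR _ (hS (Nat.zero_le n) (hxS n))
  have htend := tendsto_atTop_ciSup hmono hbdd
  set l := ⨆ n, ‖x n‖ with hl
  have hle : ∀ n, ‖x n‖ ≤ l := fun n => le_ciSup hbdd n
  have hdist : ∀ m n, m ≤ n → ‖x n - x m‖ ^ 2 ≤ 4 * (l ^ 2 - ‖x m‖ ^ 2) := by
    intro m n hmn
    have hmid : (1 / 2 : ℝ) • x n + (1 / 2 : ℝ) • x m ∈ S m :=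
      hcv m (hS hmn (hxS n)) (hxS m) (by norm_num) (by norm_num) (by norm_num)
    have h1 := hmin m _ hmid
    rw [← smul_add, norm_smul] at h1
    norm_num at h1
    have h2 := parallelogram_law_with_norm ℝ (x n) (x m)
    have h3 := hle n
    have h4 := hle m
    nlinarith [norm_nonneg (x m), norm_nonneg (x n), norm_nonneg (x n + x m)]
  have hcau : CauchySeq x := by
    rw [Metric.cauchySeq_iff']
    intro ε hε
    have hsq : Tendsto (fun n => 4 * (l ^ 2 - ‖x n‖ ^ 2)) atTop (𝓝 (4 * (l ^ 2 - l ^ 2))) :=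
      (tendsto_const_nhds.sub (htend.pow 2)).const_mul 4
    rw [sub_self, mul_zero] at hsq
    obtain ⟨m, hm⟩ := (hsq.eventually (gt_mem_nhds (pow_pos hε 2))).exists
    refine ⟨m, fun n hn => ?_⟩
    rw [dist_eq_norm]
    exact lt_of_pow_lt_pow_left₀ 2 hε.le ((hdist m n hn).trans_lt hm)
  obtain ⟨y, hy⟩ := cauchySeq_tendsto_of_complete hcau
  refine ⟨y, fun n => (hcl n).mem_of_tendsto hy ?_⟩
  filter_upwards [eventually_ge_atTop n] with m hm using hS hm (hxS m)

theorem sum_lt_comp_perm {N : ℕ} {F : Fin N → Fin N → ℝ} (hF : ∀ i j, F i j = F j i)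
    (σ : Equiv.Perm (Fin N)) :
    ∑ p ∈ Finset.univ.filter (fun p : Fin N × Fin N => p.1 < p.2), F (σ p.1) (σ p.2) =
      ∑ p ∈ Finset.univ.filter (fun p : Fin N × Fin N => p.1 < p.2), F p.1 p.2 := by
  have key : ∀ G : Fin N → Fin N → ℝ, (∀ i j, G i j = G j i) →
      2 * ∑ p ∈ Finset.univ.filter (fun p : Fin N × Fin N => p.1 < p.2), G p.1 p.2 =
        ∑ p : Fin N × Fin N, if p.1 = p.2 then 0 else G p.1 p.2 := by
    intro G hG
    have hswap : ∑ p ∈ Finset.univ.filter (fun p : Fin N × Fin N => p.1 < p.2), G p.1 p.2 =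
        ∑ p : Fin N × Fin N, if p.2 < p.1 then G p.1 p.2 else 0 := by
      rw [Finset.sum_filter]
      refine Fintype.sum_equiv (Equiv.prodComm _ _) _ _ fun p => ?_
      simp only [Equiv.prodComm_apply, Prod.fst_swap, Prod.snd_swap]
      by_cases h : p.1 < p.2
      · simp [h, hG p.1 p.2]
      · simp [h]
    rw [two_mul]
    nth_rewrite 2 [hswap]
    rw [Finset.sum_filter, ← Finset.sum_add_distrib]
    refine Finset.sum_congr rfl fun p _ => ?_
    rcases lt_trichotomy p.1 p.2 with h | h | h
    · simp [h, h.ne, h.not_gt]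
    · simp [h]
    · simp [h, h.ne', h.not_gt]
  have h1 := key (fun i j => F (σ i) (σ j)) fun i j => hF _ _
  have h2 := key F hF
  have h3 : (∑ p : Fin N × Fin N, if p.1 = p.2 then 0 else F (σ p.1) (σ p.2)) =
      ∑ p : Fin N × Fin N, if p.1 = p.2 then 0 else F p.1 p.2 := by
    refine Fintype.sum_equiv (σ.prodCongr σ) _ _ fun p => ?_
    simp [Equiv.prodCongr_apply]
  linarith

/-- For a discrete symmetric repulsive pair cost there are an optimal plan and a potential whose
sup norm is controlled by the concentration of the marginal only. -/
theorem exists_discrete_plan_bounded_potential {K : Type*} [Fintype K] [DecidableEq K] {N : ℕ}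
    (hN : 0 < N) {m : K → ℝ} (hm0 : ∀ a, 0 ≤ m a) (hm1 : ∑ a, m a = 1) {w : K → K → ℝ}
    (hws : ∀ a b, w a b = w b a) (hw0 : ∀ a b, 0 ≤ w a b) {C : ℝ} (hC : 0 ≤ C)
    (hw : ∀ a, ∑ b with C < w a b, m b ≤ 1 / (4 * (N : ℝ) ^ 2)) :
    ∃ (p : (Fin N → K) → ℝ) (v : K → ℝ), (∀ k, 0 ≤ p k) ∧
      (∀ i a, ∑ k, p k * (if k i = a then 1 else 0) = m a) ∧
      (∀ k : Fin N → K, ∑ i, v (k i) ≤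
        ∑ p ∈ Finset.univ.filter (fun p : Fin N × Fin N => p.1 < p.2), w (k p.1) (k p.2)) ∧
      (∀ a, |v a| ≤ N * (2 * C * (N : ℝ) ^ 2)) ∧
      ∀ k, p k ≠ 0 →
        ∑ p ∈ Finset.univ.filter (fun p : Fin N × Fin N => p.1 < p.2), w (k p.1) (k p.2) =
          ∑ i, v (k i) := by
  have hN1 : (1 : ℝ) ≤ N := by exact_mod_cast hN
  set M : ℝ := 2 * C * (N : ℝ) ^ 2 with hM
  have hM0 : 0 ≤ M := by positivity
  refine exists_discrete_plan_potential hN hm0 hm1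
    (γ := fun k => ∑ p ∈ Finset.univ.filter (fun p : Fin N × Fin N => p.1 < p.2),
      w (k p.1) (k p.2))
    (fun k => Finset.sum_nonneg fun p _ => hw0 _ _)
    (fun k σ => sum_lt_comp_perm (F := fun i j => w (k i) (k j)) (fun i j => hws _ _) σ) ?_
  intro v hv hmv
  have hvM : ∀ a, v a ≤ M := fun a => discrete_potential_le hN hm0 hm1 hC hw hv hmv a
  refine ⟨fun a => max (v a) (-((N - 1) * M)), ?_, ?_, ?_⟩
  · intro k
    by_cases hk : ∃ j, v (k j) < -((N - 1) * M)
    · obtain ⟨j, hj⟩ := hk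
      refine le_trans ?_ (Finset.sum_nonneg fun p _ => hw0 _ _)
      rw [← Finset.add_sum_erase _ _ (Finset.mem_univ j)]
      have h1 : ∑ i ∈ Finset.univ.erase j, max (v (k i)) (-((N - 1) * M)) ≤
          ∑ i ∈ Finset.univ.erase j, M := by
        refine Finset.sum_le_sum fun i _ => max_le (hvM _) ?_
        nlinarith
      rw [Finset.sum_const, Finset.card_erase_of_mem (Finset.mem_univ j), Finset.card_univ,
        Fintype.card_fin, nsmul_eq_mul, Nat.cast_sub hN, Nat.cast_one] at h1
      beta_reduce
      rw [max_eq_right hj.le]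
      linarith
    · push Not at hk
      refine le_trans (le_of_eq ?_) (hv k)
      exact Finset.sum_congr rfl fun i _ => max_eq_left (hk i)
  · intro a
    rw [abs_le]
    constructor
    · refine le_trans ?_ (le_max_right _ _)
      nlinarith
    · refine max_le ((hvM a).trans ?_) ?_ <;> nlinarith
  · exact Finset.sum_le_sum fun a _ => mul_le_mul_of_nonneg_left (le_max_left _ _) (hm0 a)

/-- Almost optimal pairs for the Coulomb problem, whose potentials are bounded uniformly in the
accuracy. -/
theorem exists_uniformly_bounded_almost_optimal {N : ℕ} (hN : 0 < N) (ρ : Measure E3)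
    [IsProbabilityMeasure ρ] (hρ : ∀ a, ρ {a} = 0) :
    ∃ B : ℝ, ∀ ε > 0, ∃ u : E3 → ℝ, Measurable u ∧ (∀ y, |u y| ≤ B) ∧
      (∀ x : Fin N → E3, ENNReal.ofReal (∑ i, u (x i)) ≤ coulomb N x) ∧
      ∃ P : Measure (Fin N → E3), IsProbabilityMeasure P ∧ (∀ i, P.map (fun x => x i) = ρ) ∧
        ∫⁻ x, coulomb N x ∂P ≤ ENNReal.ofReal (N * ∫ y, u y ∂ρ + ε) := by
  have hN1 : (1 : ℝ) ≤ N := by exact_mod_cast hN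
  obtain ⟨δ, hδ, hρδ⟩ := exists_forall_measureReal_closedBall_le ρ hρ
    (show (0 : ℝ) < 1 / (8 * (N : ℝ) ^ 2) by positivity)
  set B : ℝ := N * (2 * (1 / δ) * (N : ℝ) ^ 2) with hB
  have hB0 : 0 ≤ B := by positivity
  refine ⟨N * B, fun ε hε => ?_⟩
  set η : ℝ := ε / ((N : ℝ) ^ 2 * B + (N : ℝ) ^ 2) with hη
  have hη0 : 0 < η := by positivity
  have hηε : ((N : ℝ) ^ 2 * B + (N : ℝ) ^ 2) * η = ε := by
    rw [hη]
    field_simp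
  obtain ⟨K, hK1, hK2, f, w, R, hf, hws, hw0, hlow, hup, hR, hconc⟩ :=
    exists_coulomb_discretization ρ hδ hρδ (by positivity)
      (show (0 : ℝ) < N * B + 1 by positivity) hη0
  set m : K → ℝ := fun a => ρ.real (f ⁻¹' {a}) with hm
  have hm0 : ∀ a, 0 ≤ m a := fun a => measureReal_nonneg
  have hm1 : ∑ a, m a = 1 := by
    rw [hm, sum_measureReal_preimage_singleton _ fun a _ => hf a]
    simp
  obtain ⟨p, v, hp0, hpm, hv, hvB, hopt⟩ := exists_discrete_plan_bounded_potential hN hm0 hm1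
    hws hw0 (C := 1 / δ) (by positivity)
    (fun a => (hconc a).trans (le_of_eq (by field_simp; norm_num)))
  rw [← hB] at hvB
  set γ : (Fin N → K) → ℝ := fun k =>
    ∑ p ∈ Finset.univ.filter (fun p : Fin N × Fin N => p.1 < p.2), w (k p.1) (k p.2) with hγ
  have hγ0 : ∀ k, 0 ≤ γ k := fun k => Finset.sum_nonneg fun _ _ => hw0 _ _
  have hpint : ∀ i (h : K → ℝ), ∑ k, p k * h (k i) = ∑ a, m a * h a := by
    intro i h
    simp_rw [← hpm i, Finset.sum_mul]
    rw [Finset.sum_comm]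
    refine Finset.sum_congr rfl fun k _ => ?_
    rw [Finset.sum_eq_single (k i)]
    · simp
    · intro b _ hb
      simp [Ne.symm hb]
    · simp
  obtain ⟨P, hP, hPm, hPc⟩ := exists_coupling_of_discrete_plan ρ hf hN hp0 hpm
  set g : K → ℝ := fun a => if a = R then -((N - 1) * B) else v a with hg
  have hgB : ∀ a, g a ≤ B := by
    intro a
    simp only [hg]
    split_ifs
    · nlinarith
    · exact (abs_le.1 (hvB a)).2
  let _ : MeasurableSpace K := ⊤
  have hfm : Measurable f := measurable_to_countable' hf
  have hgi : ∫ y, g (f y) ∂ρ = ∑ a, m a * g a := by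
    rw [← integral_map (φ := f) (f := g) hfm.aemeasurable
      (measurable_from_top.aestronglyMeasurable), integral_fintype .of_finite]
    refine Finset.sum_congr rfl fun a _ => ?_
    rw [map_measureReal_apply hfm (MeasurableSet.singleton a), smul_eq_mul]
  refine ⟨fun y => g (f y), (measurable_from_top (f := g)).comp hfm, ?_, ?_, P, hP, hPm, ?_⟩
  · intro y
    rw [abs_le]
    refine ⟨?_, (hgB _).trans (by nlinarith)⟩
    simp only [hg]
    split_ifs
    · nlinarith
    · have := (abs_le.1 (hvB (f y))).1
      nlinarith
  · intro x
    by_cases hx : ∃ j, f (x j) = R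
    · obtain ⟨j, hj⟩ := hx
      rw [ENNReal.ofReal_of_nonpos]
      · exact zero_le
      rw [← Finset.add_sum_erase _ _ (Finset.mem_univ j)]
      have h1 : ∑ i ∈ Finset.univ.erase j, g (f (x i)) ≤ ∑ i ∈ Finset.univ.erase j, B :=
        Finset.sum_le_sum fun i _ => hgB _
      rw [Finset.sum_const, Finset.card_erase_of_mem (Finset.mem_univ j), Finset.card_univ,
        Fintype.card_fin, nsmul_eq_mul, Nat.cast_sub hN, Nat.cast_one] at h1
      have h2 : g (f (x j)) = -((N - 1) * B) := by simp [hg, hj]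
      linarith
    · push Not at hx
      have h1 : ∑ i, g (f (x i)) ≤ γ (f ∘ x) := by
        refine le_trans (le_of_eq ?_) (hv (f ∘ x))
        exact Finset.sum_congr rfl fun i _ => if_neg (hx i)
      refine (ENNReal.ofReal_le_ofReal h1).trans ?_
      rw [hγ, ENNReal.ofReal_sum_of_nonneg fun _ _ => hw0 _ _]
      exact Finset.sum_le_sum fun q _ => hlow _ _ (hx _) (hx _)
  · have hcost : ∀ x, p (f ∘ x) ≠ 0 →
        coulomb N x ≤ ENNReal.ofReal (γ (f ∘ x) + (N : ℝ) ^ 2 * η) := by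
      intro x hx
      have hγL : γ (f ∘ x) < N * B + 1 := by
        have h1 : γ (f ∘ x) = ∑ i, v ((f ∘ x) i) := hopt _ hx
        have h2 : ∑ i, v ((f ∘ x) i) ≤ ∑ _i : Fin N, B :=
          Finset.sum_le_sum fun i _ => (abs_le.1 (hvB _)).2
        simp only [Finset.sum_const, Finset.card_univ, Fintype.card_fin, nsmul_eq_mul] at h2
        linarith
      calc coulomb N x ≤ ∑ q ∈ Finset.univ.filter (fun p : Fin N × Fin N => p.1 < p.2),
            ENNReal.ofReal (w (f (x q.1)) (f (x q.2)) + η) := by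
            refine Finset.sum_le_sum fun q hq => hup _ _ (lt_of_le_of_lt ?_ hγL)
            exact Finset.single_le_sum
              (f := fun q : Fin N × Fin N => w ((f ∘ x) q.1) ((f ∘ x) q.2))
              (fun _ _ => hw0 _ _) hq
        _ = ENNReal.ofReal (∑ q ∈ Finset.univ.filter (fun p : Fin N × Fin N => p.1 < p.2),
            (w (f (x q.1)) (f (x q.2)) + η)) :=
            (ENNReal.ofReal_sum_of_nonneg fun _ _ => add_nonneg (hw0 _ _) hη0.le).symm
        _ ≤ _ := by
            refine ENNReal.ofReal_le_ofReal ?_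
            rw [Finset.sum_add_distrib, Finset.sum_const, nsmul_eq_mul]
            have hcard : (((Finset.univ.filter
                (fun p : Fin N × Fin N => p.1 < p.2)).card : ℕ) : ℝ) ≤ (N : ℝ) ^ 2 := by
              have := Finset.card_le_univ
                (Finset.univ.filter (fun p : Fin N × Fin N => p.1 < p.2))
              rw [Fintype.card_prod, Fintype.card_fin] at this
              rw [sq]
              exact_mod_cast this
            exact add_le_add le_rfl (mul_le_mul_of_nonneg_right hcard hη0.le)
    refine (hPc (coulomb N) (fun k => ENNReal.ofReal (γ k + (N : ℝ) ^ 2 * η)) hcost).trans ?_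
    have hterm : ∀ k, ENNReal.ofReal (p k) * ENNReal.ofReal (γ k + (N : ℝ) ^ 2 * η) =
        ENNReal.ofReal (p k * (∑ i, v (k i)) + p k * ((N : ℝ) ^ 2 * η)) := by
      intro k
      rw [← ENNReal.ofReal_mul (hp0 k), ← mul_add]
      by_cases hk : p k = 0
      · simp [hk]
      · rw [← hopt k hk]
    have hnn : ∀ k, 0 ≤ p k * (∑ i, v (k i)) + p k * ((N : ℝ) ^ 2 * η) := by
      intro k
      by_cases hk : p k = 0
      · simp [hk]
      · rw [← hopt k hk]
        have := hγ0 k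
        have := hp0 k
        positivity
    simp_rw [hterm]
    rw [← ENNReal.ofReal_sum_of_nonneg fun k _ => hnn k, Finset.sum_add_distrib,
      ← Finset.sum_mul]
    refine ENNReal.ofReal_le_ofReal ?_
    have hp1 : ∑ k, p k = 1 := by
      have := hpint ⟨0, hN⟩ fun _ => 1
      simpa [hm1] using this
    have hpv : ∑ k, p k * ∑ i, v (k i) = N * ∑ a, m a * v a := by
      simp_rw [Finset.mul_sum]
      rw [Finset.sum_comm]
      simp_rw [hpint, Finset.sum_const, Finset.card_univ, Fintype.card_fin, nsmul_eq_mul,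
        Finset.mul_sum]
    have hloss : ∑ a, m a * v a ≤ ∑ a, m a * g a + m R * (N * B) := by
      have : ∀ a, m a * v a ≤ m a * g a + if a = R then m R * (N * B) else 0 := by
        intro a
        by_cases ha : a = R
        · subst ha
          have h1 := (abs_le.1 (hvB a)).2
          simp only [hg, if_true]
          have := mul_le_mul_of_nonneg_left h1 (hm0 a)
          linarith
        · simp [hg, ha]
      refine (Finset.sum_le_sum fun a _ => this a).trans (le_of_eq ?_)
      rw [Finset.sum_add_distrib, Finset.sum_ite_eq' Finset.univ R, if_pos (Finset.mem_univ R)]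
    have hmR : N * (m R * (N * B)) ≤ (N : ℝ) ^ 2 * B * η := by
      have h1 : m R * ((N : ℝ) ^ 2 * B) ≤ η * ((N : ℝ) ^ 2 * B) :=
        mul_le_mul_of_nonneg_right hR (by positivity)
      linarith
    rw [hp1, hpv, hgi]
    have := mul_le_mul_of_nonneg_left hloss (show (0 : ℝ) ≤ N by linarith)
    linarith

theorem ae_pi_forall_of_ae {X : Type*} [MeasurableSpace X] {ρ : Measure X} [SigmaFinite ρ] {N : ℕ}
    {q : X → Prop} (h : ∀ᵐ y ∂ρ, q y) : ∀ᵐ x ∂(Measure.pi fun _ : Fin N => ρ), ∀ i, q (x i) := by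
  rw [ae_all_iff]
  exact fun i => (Measure.quasiMeasurePreserving_eval (μ := fun _ : Fin N => ρ) i).ae h

theorem integrable_of_abs_le {X : Type*} [MeasurableSpace X] {ρ : Measure X} [IsFiniteMeasure ρ]
    {u : X → ℝ} {B : ℝ} (hu : AEStronglyMeasurable u ρ) (hB : ∀ᵐ y ∂ρ, |u y| ≤ B) :
    Integrable u ρ :=
  Integrable.of_bound hu B hB

/-- Uniformly bounded admissible potentials which are almost optimal can be replaced by an optimal
one. -/
theorem exists_bounded_potential_of_almost_optimal {X : Type*} [MeasurableSpace X] {ρ : Measure X}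
    [IsProbabilityMeasure ρ] {N : ℕ} {c : (Fin N → X) → ℝ≥0∞} {B D : ℝ}
    (h : ∀ ε > 0, ∃ u : X → ℝ, Measurable u ∧ (∀ y, |u y| ≤ B) ∧
      (∀ x, ENNReal.ofReal (∑ i, u (x i)) ≤ c x) ∧ D ≤ N * ∫ y, u y ∂ρ + ε) :
    ∃ u : X → ℝ, Measurable u ∧ (∀ y, |u y| ≤ B) ∧
      (∀ᵐ x ∂(Measure.pi fun _ : Fin N => ρ), ENNReal.ofReal (∑ i, u (x i)) ≤ c x) ∧
      D ≤ N * ∫ y, u y ∂ρ := by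
  have hX : Nonempty X := nonempty_of_isProbabilityMeasure ρ
  have hB0 : 0 ≤ B := by
    obtain ⟨u, -, hu, -⟩ := h 1 one_pos
    exact (abs_nonneg _).trans (hu hX.some)
  let S : ℕ → Set (Lp ℝ 2 ρ) := fun n => {u | (∀ᵐ y ∂ρ, |u y| ≤ B) ∧
    (∀ᵐ x ∂(Measure.pi fun _ : Fin N => ρ), ENNReal.ofReal (∑ i, u (x i)) ≤ c x) ∧
    D ≤ N * ∫ y, u y ∂ρ + 1 / (n + 1)}
  have hanti : Antitone S := by
    rintro m n hmn u ⟨h1, h2, h3⟩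
    refine ⟨h1, h2, h3.trans ?_⟩
    have := Nat.one_div_le_one_div (α := ℝ) hmn
    linarith
  have hne : ∀ n, (S n).Nonempty := by
    intro n
    obtain ⟨u, hu, huB, hua, huD⟩ := h (1 / ((n : ℝ) + 1)) Nat.one_div_pos_of_nat
    have hmem : MemLp u 2 ρ := MemLp.of_bound hu.aestronglyMeasurable B (ae_of_all _ huB)
    have hae := hmem.coeFn_toLp
    refine ⟨hmem.toLp u, ?_, ?_, ?_⟩
    · filter_upwards [hae] with y hy
      rw [hy]
      exact huB y
    · filter_upwards [ae_pi_forall_of_ae (N := N) hae] with x hx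
      simp only [hx]
      exact hua x
    · rwa [integral_congr_ae hae]
  have hcv : ∀ n, Convex ℝ (S n) := by
    rintro n u ⟨hu1, hu2, hu3⟩ v ⟨hv1, hv2, hv3⟩ a b ha hb hab
    have hae : ∀ᵐ y ∂ρ, (a • u + b • v : Lp ℝ 2 ρ) y = a * u y + b * v y := by
      filter_upwards [Lp.coeFn_add (a • u) (b • v), Lp.coeFn_smul a u, Lp.coeFn_smul b v]
        with y h1 h2 h3
      rw [h1, Pi.add_apply, h2, h3]
      simp
    refine ⟨?_, ?_, ?_⟩
    · filter_upwards [hae, hu1, hv1] with y hy h1 h2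
      rw [hy]
      rw [abs_le] at *
      constructor <;> nlinarith
    · filter_upwards [ae_pi_forall_of_ae (N := N) hae, hu2, hv2] with x hx h1 h2
      simp only [hx, Finset.sum_add_distrib, ← Finset.mul_sum]
      rcases le_total (∑ i, u (x i)) (∑ i, v (x i)) with hle | hle
      · refine (ENNReal.ofReal_le_ofReal ?_).trans h2
        have hle' := mul_le_mul_of_nonneg_left hle ha
        rw [← eq_sub_iff_add_eq] at hab
        subst hab
        linarith
      · refine (ENNReal.ofReal_le_ofReal ?_).trans h1
        have hle' := mul_le_mul_of_nonneg_left hle hb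
        rw [← eq_sub_iff_add_eq] at hab
        subst hab
        linarith
    · rw [integral_congr_ae hae, integral_add
        ((integrable_of_abs_le (Lp.aestronglyMeasurable u) hu1).const_mul a)
        ((integrable_of_abs_le (Lp.aestronglyMeasurable v) hv1).const_mul b),
        integral_const_mul, integral_const_mul]
      have h1 := mul_le_mul_of_nonneg_left hu3 ha
      have h2 := mul_le_mul_of_nonneg_left hv3 hb
      have hb' : b = 1 - a := by linarith
      subst hb'
      linarith
  have hcl : ∀ n, IsClosed (S n) := by
    intro n
    refine IsSeqClosed.isClosed ?_
    intro s u hs hsu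
    obtain ⟨φ, -, hφ⟩ := (tendstoInMeasure_of_tendsto_Lp hsu).exists_seq_tendsto_ae
    have hall : ∀ᵐ y ∂ρ, ∀ j, |s (φ j) y| ≤ B := ae_all_iff.2 fun j => (hs (φ j)).1
    refine ⟨?_, ?_, ?_⟩
    · filter_upwards [hφ, hall] with y hy hyB
      exact le_of_tendsto hy.abs (Eventually.of_forall hyB)
    · have hadm : ∀ᵐ x ∂(Measure.pi fun _ : Fin N => ρ), ∀ j,
          ENNReal.ofReal (∑ i, s (φ j) (x i)) ≤ c x := ae_all_iff.2 fun j => (hs (φ j)).2.1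
      filter_upwards [ae_pi_forall_of_ae (N := N) hφ, hadm] with x hx hxa
      refine le_of_tendsto (ENNReal.tendsto_ofReal (tendsto_finsetSum _ fun i _ => hx i))
        (Eventually.of_forall hxa)
    · have hlim : Tendsto (fun j => ∫ y, s (φ j) y ∂ρ) atTop (𝓝 (∫ y, u y ∂ρ)) :=
        tendsto_integral_of_dominated_convergence (fun _ => B)
          (fun j => Lp.aestronglyMeasurable _) (integrable_const B)
          (fun j => (hs (φ j)).1) hφ
      exact ge_of_tendsto ((hlim.const_mul (N : ℝ)).add_const _)
        (Eventually.of_forall fun j => (hs (φ j)).2.2)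
  obtain ⟨u, hu⟩ := exists_forall_mem_of_antitone_isClosed_convex hanti hne hcl hcv
    (fun u hu => Lp.norm_le_of_ae_bound hB0 hu.1)
  obtain ⟨hu1, hu2, -⟩ := hu 0
  have hD : D ≤ N * ∫ y, u y ∂ρ := by
    have hlim : Tendsto (fun n : ℕ => N * ∫ y, u y ∂ρ + 1 / ((n : ℝ) + 1)) atTop
        (𝓝 (N * ∫ y, u y ∂ρ + 0)) := tendsto_one_div_add_atTop_nhds_zero_nat.const_add _
    rw [add_zero] at hlim
    exact ge_of_tendsto hlim (Eventually.of_forall fun n => (hu n).2.2)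
  have hclamp : ∀ᵐ y ∂ρ, max (-B) (min B (u y)) = u y := by
    filter_upwards [hu1] with y hy
    rw [abs_le] at hy
    rw [min_eq_right hy.2, max_eq_right hy.1]
  refine ⟨fun y => max (-B) (min B (u y)), ?_, ?_, ?_, ?_⟩
  · exact measurable_const.max (measurable_const.min (Lp.stronglyMeasurable u).measurable)
  · intro y
    rw [abs_le]
    exact ⟨le_max_left _ _, max_le (by linarith) (min_le_left _ _)⟩
  · filter_upwards [ae_pi_forall_of_ae (N := N) hclamp, hu2] with x hx hxa
    simpa only [hx] using hxa
  · rwa [integral_congr_ae hclamp]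

/-- Kantorovich duality for the multimarginal Coulomb cost: the minimal
transportation cost over Π(ρ) equals the supremum of the dual problem, and the dual
problem admits a bounded maximizer (a bounded Kantorovich potential). -/
theorem stmt17 (N : ℕ) (hN : 2 ≤ N) (ρ : Measure E3) [IsProbabilityMeasure ρ]
    (hat : ∀ a : E3, ρ {a} = 0)
    (hnc : ¬ ∃ S : Finset E3, S.card ≤ N - 1 ∧ ρ ↑S = 1)
    (hfin : ∃ P : Measure (Fin N → E3), IsProbabilityMeasure P ∧
      (∀ i : Fin N, P.map (fun x => x i) = ρ) ∧ ∫⁻ x, coulomb N x ∂P ≠ ⊤) :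
    ∃ u : E3 → ℝ, Integrable u ρ ∧ (∃ M : ℝ, ∀ y, |u y| ≤ M) ∧
      (∀ᵐ x ∂(Measure.pi fun _ : Fin N => ρ),
        ENNReal.ofReal (∑ i, u (x i)) ≤ coulomb N x) ∧
      (∀ v : E3 → ℝ, Integrable v ρ →
        (∀ᵐ x ∂(Measure.pi fun _ : Fin N => ρ),
          ENNReal.ofReal (∑ i, v (x i)) ≤ coulomb N x) →
        (N : ℝ) * ∫ y, v y ∂ρ ≤ (N : ℝ) * ∫ y, u y ∂ρ) ∧
      sInf {v : ℝ≥0∞ | ∃ P : Measure (Fin N → E3), IsProbabilityMeasure P ∧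
          (∀ i : Fin N, P.map (fun x => x i) = ρ) ∧ v = ∫⁻ x, coulomb N x ∂P} =
        ENNReal.ofReal ((N : ℝ) * ∫ y, u y ∂ρ) := by
  have hN0 : 0 < N := by omega
  set D : ℝ≥0∞ := sInf {v : ℝ≥0∞ | ∃ P : Measure (Fin N → E3), IsProbabilityMeasure P ∧
    (∀ i : Fin N, P.map (fun x => x i) = ρ) ∧ v = ∫⁻ x, coulomb N x ∂P} with hD
  obtain ⟨B, hB⟩ := exists_uniformly_bounded_almost_optimal hN0 ρ hat
  have hDle : ∀ ε > 0, ∃ u : E3 → ℝ, Measurable u ∧ (∀ y, |u y| ≤ B) ∧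
      (∀ x : Fin N → E3, ENNReal.ofReal (∑ i, u (x i)) ≤ coulomb N x) ∧
      D ≤ ENNReal.ofReal (N * ∫ y, u y ∂ρ + ε) := by
    intro ε hε
    obtain ⟨u, hu, huB, hua, P, hP, hPm, hPc⟩ := hB ε hε
    have hle : D ≤ ∫⁻ x, coulomb N x ∂P := sInf_le ⟨P, hP, hPm, rfl⟩
    exact ⟨u, hu, huB, hua, hle.trans hPc⟩
  have hDtop : D ≠ ⊤ := by
    obtain ⟨u, -, -, -, hu⟩ := hDle 1 one_pos
    exact (hu.trans_lt ENNReal.ofReal_lt_top).ne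
  have hweak : ∀ v : E3 → ℝ, Integrable v ρ →
      (∀ᵐ x ∂(Measure.pi fun _ : Fin N => ρ), ENNReal.ofReal (∑ i, v (x i)) ≤ coulomb N x) →
      ENNReal.ofReal (N * ∫ y, v y ∂ρ) ≤ D := by
    intro v hv hva
    refine le_sInf ?_
    rintro _ ⟨P, -, hPm, rfl⟩
    exact ofReal_integral_le_lintegral_of_ae_pi (continuous_coulomb N) hv hva hPm
  have happrox : ∀ ε > 0, ∃ u : E3 → ℝ, Measurable u ∧ (∀ y, |u y| ≤ B) ∧
      (∀ x : Fin N → E3, ENNReal.ofReal (∑ i, u (x i)) ≤ coulomb N x) ∧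
      D.toReal ≤ N * ∫ y, u y ∂ρ + ε := by
    intro ε hε
    obtain ⟨u, hu, huB, hua, huD⟩ := hDle ε hε
    rcases le_total 0 (N * ∫ y, u y ∂ρ + ε) with h0 | h0
    · exact ⟨u, hu, huB, hua, ENNReal.toReal_le_of_le_ofReal h0 huD⟩
    · refine ⟨fun _ => 0, measurable_const, fun y => ?_, fun x => by simp, ?_⟩
      · simpa using (abs_nonneg _).trans (huB y)
      · rw [ENNReal.ofReal_of_nonpos h0, nonpos_iff_eq_zero] at huD
        simp [huD, hε.le]
  obtain ⟨u, hu, huB, hua, huD⟩ := exists_bounded_potential_of_almost_optimal happrox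
  have hui : Integrable u ρ := integrable_of_abs_le hu.aestronglyMeasurable (ae_of_all _ huB)
  have hDu : D = ENNReal.ofReal (N * ∫ y, u y ∂ρ) := by
    refine le_antisymm ?_ (hweak u hui hua)
    rw [← ENNReal.ofReal_toReal hDtop]
    exact ENNReal.ofReal_le_ofReal huD
  refine ⟨u, hui, ⟨B, huB⟩, hua, fun v hv hva => ?_, hDu⟩
  have h := hweak v hv hva
  rwa [hDu, ENNReal.ofReal_le_ofReal_iff (ENNReal.toReal_nonneg.trans huD)] at h
end
end
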